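/- arXiv:1609.09634 — 2 statements merged into one kernel-verified Lean document; each statement's English description precedes it below -/
import Mathlib

section
/- (Ergodicity bound for the inhomogeneous queue with batch arrivals and state-dependent single services, class II.) For any two solutions p*, p** of the forward Kolmogorov system and any 0 ≤ s ≤ t with ‖z*(s) − z**(s)‖_{1D} < ∞, one has ‖p*(t) − p**(t)‖ ≤ 4·exp(−∫_s^t α(u) du)·‖z*(s) − z**(s)‖_{1D}, where α(t) = inf_{j≥1} α_j(t) and α_j(t) = μ_j(t) − (d_{j−1}/d_j)·μ_{j−1}(t) + Σ_{i≥1} (1 − d_{i+j}/d_j)·λ_i(t) (with the convention that the term (d_0/d_1)μ_0 is 0). Consequently, if ∫_0^∞ α(t) dt = +∞, then ‖p*(t) − p**(t)‖ → 0 as t → ∞ (the chain is weakly ergodic). -/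
open MeasureTheory intervalIntegral Filter
open scoped Topology

noncomputable section

/-- `p : ℝ → ℕ → ℝ` is a solution of the forward Kolmogorov system `dp/dt = A(t)p(t)` with
transposed intensity matrix `a`: each `p t` (for `t ≥ 0`) is a stochastic vector, and the
integral form `p_i(t) = p_i(s) + ∫_s^t Σ_j a_{ij}(u) p_j(u) du` of the equations holds for
all `i ≥ 0` and `0 ≤ s ≤ t`. -/
def IsKolmogorovSolution (a : ℕ → ℕ → ℝ → ℝ) (p : ℝ → ℕ → ℝ) : Prop :=
  (∀ t : ℝ, 0 ≤ t → (∀ i, 0 ≤ p t i) ∧ HasSum (p t) 1) ∧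
  (∀ i : ℕ, ∀ s t : ℝ, 0 ≤ s → s ≤ t →
    p t i = p s i + ∫ u in s..t, ∑' j : ℕ, a i j u * p u j)

/-- The weighted norm `‖w‖_{1D} = Σ_{k≥1} d_k |Σ_{i≥k} w_i|` (the coordinate `w 0` is not
used, and `d k` only matters for `k ≥ 1`). -/
def norm1D (d : ℕ → ℝ) (w : ℕ → ℝ) : ℝ :=
  ∑' k : ℕ, d (k + 1) * |∑' i : ℕ, w (k + 1 + i)|

/-- Summability of the series defining `‖w‖_{1D}`, i.e. `‖w‖_{1D} < ∞`. -/
def Norm1DFinite (d : ℕ → ℝ) (w : ℕ → ℝ) : Prop :=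
  Summable (fun k : ℕ => d (k + 1) * |∑' i : ℕ, w (k + 1 + i)|)


/-- The transposed intensity matrix of the queue with state-independent batch arrivals of
size `k ≥ 1` at intensity `λ_k(t)` and state-dependent single services at intensity
`μ_n(t)` (with `μ_0 := 0`): `a_{j+k,j}(t) = λ_k(t)` for `k ≥ 1`, `a_{j−1,j}(t) = μ_j(t)`,
`a_{jj}(t) = −(Σ_{k≥1} λ_k(t) + μ_j(t))`. -/
def classIIMatrix (lam mu : ℕ → ℝ → ℝ) (i j : ℕ) (t : ℝ) : ℝ :=
  if j + 1 ≤ i then lam (i - j) t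
  else if i + 1 = j then mu j t
  else if i = j then -((∑' k : ℕ, lam (k + 1) t) + mu j t)
  else 0

/-- `α_j(t) = μ_j(t) − (d_{j−1}/d_j)μ_{j−1}(t) + Σ_{i≥1}(1 − d_{i+j}/d_j)λ_i(t)` (the
argument `j` below stands for the state index `j ≥ 1`; the term `(d_0/d_1)μ_0` vanishes
since `μ_0 = 0`). -/
def alphaIIj (d : ℕ → ℝ) (lam mu : ℕ → ℝ → ℝ) (j : ℕ) (t : ℝ) : ℝ :=
  mu j t - (d (j - 1) / d j) * mu (j - 1) t
    + ∑' i : ℕ, (1 - d (i + 1 + j) / d j) * lam (i + 1) t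

/-- `α(t) = inf_{j≥1} α_j(t)`. -/
def alphaII (d : ℕ → ℝ) (lam mu : ℕ → ℝ → ℝ) (t : ℝ) : ℝ :=
  ⨅ j : ℕ, alphaIIj d lam mu (j + 1) t

namespace ClassII
open scoped ENNReal

lemma exp_half (L K : ℝ) (hL : 0 ≤ L) (hK : 0 ≤ K) (n : ℕ) (s t : ℝ) (hst : s ≤ t) :
    ∫⁻ u in Set.Ioc s t, ENNReal.ofReal L *
      ENNReal.ofReal (K * (1/2)^n * Real.exp (2 * L * (u - s))) ≤
    ENNReal.ofReal (K * (1/2)^(n+1) * Real.exp (2 * L * (t - s))) := by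
  have h1 : ∀ u, ENNReal.ofReal L * ENNReal.ofReal (K * (1/2)^n * Real.exp (2 * L * (u - s)))
      = ENNReal.ofReal (L * (K * (1/2)^n * Real.exp (2 * L * (u - s)))) := fun u => by
    rw [ENNReal.ofReal_mul hL]
  simp_rw [h1]
  have hc : Continuous (fun u : ℝ => L * (K * (1/2)^n * Real.exp (2 * L * (u - s)))) := by
    fun_prop
  rw [← ofReal_integral_eq_lintegral_ofReal
    (hc.integrableOn_Icc.mono_set Set.Ioc_subset_Icc_self)
    (Eventually.of_forall fun u => by positivity)]
  apply ENNReal.ofReal_le_ofReal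
  rw [← intervalIntegral.integral_of_le hst]
  have hd : ∀ u ∈ Set.uIcc s t, HasDerivAt
      (fun u : ℝ => K * (1/2)^(n+1) * Real.exp (2 * L * (u - s)))
      (L * (K * (1/2)^n * Real.exp (2 * L * (u - s)))) u := by
    intro u _
    have := (((hasDerivAt_id u).sub_const s).const_mul (2 * L)).exp.const_mul (K * (1/2)^(n+1))
    refine HasDerivAt.congr_deriv this ?_
    simp only [id_eq]
    ring
  rw [intervalIntegral.integral_eq_sub_of_hasDerivAt hd (hc.intervalIntegrable _ _)]
  have : 0 ≤ K * (1/2)^(n+1) * Real.exp (2 * L * (s - s)) := by positivity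
  linarith

/-- Abstract Picard / Gronwall comparison for infinite systems. -/
lemma core (m : ℕ → ℝ → ℝ≥0∞) (C : ℕ → ℕ → ℝ → ℝ≥0∞) (d : ℕ → ℝ≥0∞) (s T L K : ℝ)
    (hsT : s ≤ T) (hL : 0 ≤ L) (hK : 0 ≤ K) (hd : ∀ k, d k ≠ ⊤)
    (hC : ∀ k j, AEMeasurable (C k j) (volume.restrict (Set.Ioc s T)))
    (h F : ℝ → ℝ≥0∞)
    (hrow : ∀ᵐ u ∂(volume.restrict (Set.Ioc s T)), ∀ k, ∑' j, C k j u ≤ ENNReal.ofReal L)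
    (hcol : ∀ᵐ u ∂(volume.restrict (Set.Ioc s T)), ∀ j, ∑' k, d k * C k j u ≤ h u * d j)
    (hm : ∀ k, ∀ t ∈ Set.Icc s T,
      m k t ≤ m k s + ∫⁻ u in Set.Ioc s t, ∑' j, C k j u * m j u)
    (hbd : ∀ k, ∀ t ∈ Set.Icc s T, m k t ≤ ENNReal.ofReal K)
    (hF : ∀ t ∈ Set.Icc s T, ∑' k, d k * m k s + ∫⁻ u in Set.Ioc s t, h u * F u ≤ F t) :
    ∑' k, d k * m k T ≤ F T := by
  have key : ∀ n : ℕ, ∃ a : ℕ → ℝ → ℝ≥0∞, (∀ k, Measurable (a k)) ∧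
      (∀ k, ∀ t ∈ Set.Icc s T, m k t ≤ a k t +
        ENNReal.ofReal (K * (1/2)^n * Real.exp (2 * L * (t - s)))) ∧
      (∀ t ∈ Set.Icc s T, ∑' k, d k * a k t ≤ F t) := by
    intro n
    induction n with
    | zero =>
      refine ⟨fun _ _ => 0, fun _ => measurable_const, ?_, by simp⟩
      intro k t ht
      refine (hbd k t ht).trans ?_
      rw [zero_add]
      apply ENNReal.ofReal_le_ofReal
      have : 1 ≤ Real.exp (2 * L * (t - s)) :=
        Real.one_le_exp (mul_nonneg (by positivity) (by linarith [ht.1]))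
      simp only [pow_zero, mul_one]
      nlinarith
    | succ n ih =>
      obtain ⟨a, ha, hma, hda⟩ := ih
      refine ⟨fun k t => m k s + ∫⁻ u in Set.Ioc s t, ∑' j, C k j u * a j u, ?_, ?_, ?_⟩
      · intro k
        apply Monotone.measurable
        intro t t' htt'
        dsimp only
        gcongr
      · intro k t ht
        have hsub : Set.Ioc s t ⊆ Set.Ioc s T := Set.Ioc_subset_Ioc_right ht.2
        have hle : volume.restrict (Set.Ioc s t) ≤ volume.restrict (Set.Ioc s T) :=
          Measure.restrict_mono hsub le_rfl
        have hrow' := ae_mono hle hrow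
        have hmem : ∀ᵐ u ∂(volume.restrict (Set.Ioc s t)), u ∈ Set.Ioc s t :=
          ae_restrict_mem measurableSet_Ioc
        refine (hm k t ht).trans ?_
        rw [add_assoc]
        gcongr
        calc ∫⁻ u in Set.Ioc s t, ∑' j, C k j u * m j u
            ≤ ∫⁻ u in Set.Ioc s t, (∑' j, C k j u * a j u + ENNReal.ofReal L *
                ENNReal.ofReal (K * (1/2)^n * Real.exp (2 * L * (u - s)))) := by
              apply lintegral_mono_ae
              filter_upwards [hrow', hmem] with u hu hu2
              calc ∑' j, C k j u * m j u
                  ≤ ∑' j, (C k j u * a j u + C k j u *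
                    ENNReal.ofReal (K * (1/2)^n * Real.exp (2 * L * (u - s)))) := by
                    gcongr with j
                    rw [← mul_add]
                    gcongr
                    exact hma j u ⟨hu2.1.le, hu2.2.trans ht.2⟩
                _ = _ := by rw [ENNReal.tsum_add, ENNReal.tsum_mul_right]
                _ ≤ _ := by gcongr; exact hu k
          _ = _ := lintegral_add_right _ (by fun_prop)
          _ ≤ _ := by gcongr; exact exp_half L K hL hK n s t ht.1
      · intro t ht
        have hsub : Set.Ioc s t ⊆ Set.Ioc s T := Set.Ioc_subset_Ioc_right ht.2
        have hle : volume.restrict (Set.Ioc s t) ≤ volume.restrict (Set.Ioc s T) :=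
          Measure.restrict_mono hsub le_rfl
        have hcol' := ae_mono hle hcol
        have hC' : ∀ k j, AEMeasurable (C k j) (volume.restrict (Set.Ioc s t)) :=
          fun k j => (hC k j).mono_measure hle
        have hmem : ∀ᵐ u ∂(volume.restrict (Set.Ioc s t)), u ∈ Set.Ioc s t :=
          ae_restrict_mem measurableSet_Ioc
        refine le_trans ?_ (hF t ht)
        simp_rw [mul_add]
        rw [ENNReal.tsum_add]
        gcongr
        have h1 : ∀ k, d k * ∫⁻ u in Set.Ioc s t, ∑' j, C k j u * a j u =
            ∫⁻ u in Set.Ioc s t, d k * ∑' j, C k j u * a j u := fun k => by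
          rw [lintegral_const_mul' _ _ (hd k)]
        simp_rw [h1]
        have hmeas : ∀ k, AEMeasurable (fun u => d k * ∑' j, C k j u * a j u)
            (volume.restrict (Set.Ioc s t)) := fun k =>
          AEMeasurable.const_mul (AEMeasurable.tsum
            (fun j => (hC' k j).mul (ha j).aemeasurable)) _
        rw [← lintegral_tsum hmeas]
        apply lintegral_mono_ae
        filter_upwards [hcol', hmem] with u hu hu2
        calc ∑' k, d k * ∑' j, C k j u * a j u
            = ∑' k, ∑' j, d k * C k j u * a j u := by
              simp_rw [← ENNReal.tsum_mul_left, mul_assoc]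
          _ = ∑' j, ∑' k, d k * C k j u * a j u := ENNReal.tsum_comm
          _ = ∑' j, (∑' k, d k * C k j u) * a j u := by simp_rw [ENNReal.tsum_mul_right]
          _ ≤ ∑' j, (h u * d j) * a j u := by gcongr with j; exact hu j
          _ = h u * ∑' j, d j * a j u := by simp_rw [← ENNReal.tsum_mul_left, mul_assoc]
          _ ≤ _ := by gcongr; exact hda u ⟨hu2.1.le, hu2.2.trans ht.2⟩
  have hTm : T ∈ Set.Icc s T := ⟨hsT, le_rfl⟩
  apply ENNReal.tsum_le_of_sum_range_le
  intro N
  have hb : ∀ n : ℕ, ∑ k ∈ Finset.range N, d k * m k T ≤ F T +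
      (∑ k ∈ Finset.range N, d k) *
        ENNReal.ofReal (K * (1/2)^n * Real.exp (2 * L * (T - s))) := by
    intro n
    obtain ⟨a, ha, hma, hda⟩ := key n
    calc _ ≤ ∑ k ∈ Finset.range N, (d k * a k T + d k *
          ENNReal.ofReal (K * (1/2)^n * Real.exp (2 * L * (T - s)))) := by
          gcongr with k
          rw [← mul_add]
          gcongr
          exact hma k T hTm
      _ = ∑ k ∈ Finset.range N, d k * a k T + (∑ k ∈ Finset.range N, d k) *
          ENNReal.ofReal (K * (1/2)^n * Real.exp (2 * L * (T - s))) := by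
          rw [Finset.sum_add_distrib, Finset.sum_mul]
      _ ≤ _ := by
          gcongr
          exact (ENNReal.sum_le_tsum _).trans (hda T hTm)
  have hlim : Tendsto (fun n : ℕ => F T + (∑ k ∈ Finset.range N, d k) *
        ENNReal.ofReal (K * (1/2)^n * Real.exp (2 * L * (T - s)))) atTop
        (𝓝 (F T + (∑ k ∈ Finset.range N, d k) * ENNReal.ofReal 0)) := by
    apply Tendsto.const_add
    apply ENNReal.Tendsto.const_mul
    · apply ENNReal.tendsto_ofReal
      have := ((tendsto_pow_atTop_nhds_zero_of_lt_one (r := (1/2 : ℝ)) (by norm_num)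
        (by norm_num)).const_mul K).mul_const (Real.exp (2 * L * (T - s)))
      simpa using this
    · right
      exact ENNReal.sum_ne_top.2 (fun k _ => hd k)
  simp only [ENNReal.ofReal_zero, mul_zero, add_zero] at hlim
  exact ge_of_tendsto' hlim hb

lemma exp_gronwall (h : ℝ → ℝ) (s T V : ℝ) (hV : 0 ≤ V)
    (hi : IntervalIntegrable h volume s T)
    (h0 : ∀ᵐ u ∂(volume.restrict (Set.Ioc s T)), 0 ≤ h u) (t : ℝ) (ht : t ∈ Set.Icc s T) :
    ENNReal.ofReal V + ∫⁻ u in Set.Ioc s t, ENNReal.ofReal (h u) *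
      ENNReal.ofReal (V * Real.exp (∫ v in s..u, h v)) ≤
    ENNReal.ofReal (V * Real.exp (∫ v in s..t, h v)) := by
  have hst := ht.1
  have hi' : IntervalIntegrable h volume s t := hi.mono_set (by
    rw [Set.uIcc_of_le hst, Set.uIcc_of_le (hst.trans ht.2)]
    exact Set.Icc_subset_Icc_right ht.2)
  have h0' : ∀ᵐ u ∂(volume.restrict (Set.Ioc s t)), 0 ≤ h u :=
    ae_mono (Measure.restrict_mono (Set.Ioc_subset_Ioc_right ht.2) le_rfl) h0
  have hsub : ∀ a b, s ≤ a → a ≤ b → b ≤ t → IntervalIntegrable h volume a b := by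
    intro a b ha hab hb
    apply hi'.mono_set
    rw [Set.uIcc_of_le hab, Set.uIcc_of_le hst]
    exact Set.Icc_subset_Icc ha hb
  set E : ℝ → ℝ := fun u => V * Real.exp (∫ v in s..u, h v) with hE
  have hmono : MonotoneOn E (Set.uIcc s t) := by
    rw [Set.uIcc_of_le hst]
    intro a ha b hb hab
    simp only [hE]
    gcongr
    rw [← intervalIntegral.integral_add_adjacent_intervals (hsub s a le_rfl ha.1 ha.2)
      (hsub a b ha.1 hab hb.2)]
    have : 0 ≤ ∫ v in a..b, h v := by
      apply intervalIntegral.integral_nonneg_of_ae_restrict hab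
      rw [EventuallyLE, ← restrict_Ioc_eq_restrict_Icc]
      exact ae_mono (Measure.restrict_mono (Set.Ioc_subset_Ioc ha.1 hb.2) le_rfl) h0'
    linarith
  have hder : ∀ᵐ u ∂(volume.restrict (Set.Ioc s t)), deriv E u = h u * E u := by
    rw [ae_restrict_iff' measurableSet_Ioc]
    filter_upwards [hi'.ae_hasDerivAt_integral] with u hu hus
    have hu' := hu (by rw [Set.uIcc_of_le hst]; exact Set.Ioc_subset_Icc_self hus) s (by simp)
    have := (hu'.exp.const_mul V).deriv
    rw [hE, this]; ring
  have h1 := hmono.intervalIntegral_deriv_mem_uIcc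
  have hEle : E s ≤ E t := hmono (by simp) (by simp) hst
  rw [Set.uIcc_of_le (by linarith)] at h1
  have hEs : E s = V := by simp [hE]
  have hEint : IntegrableOn (deriv E) (Set.Ioc s t) :=
    (intervalIntegrable_iff_integrableOn_Ioc_of_le hst).1 hmono.intervalIntegrable_deriv
  have h2 : ∫⁻ u in Set.Ioc s t, ENNReal.ofReal (h u) *
      ENNReal.ofReal (V * Real.exp (∫ v in s..u, h v)) =
      ENNReal.ofReal (∫ u in s..t, deriv E u) := by
    rw [intervalIntegral.integral_of_le hst, ofReal_integral_eq_lintegral_ofReal hEint]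
    · apply lintegral_congr_ae
      filter_upwards [hder, h0'] with u hu hu0
      rw [hu, ENNReal.ofReal_mul hu0]
    · filter_upwards [hder, h0'] with u hu hu0
      rw [hu]; simp only [hE, Pi.zero_apply]; positivity
  rw [h2, ← ENNReal.ofReal_add hV h1.1]
  apply ENNReal.ofReal_le_ofReal
  have := h1.2
  change V + _ ≤ E t
  linarith

lemma exp_mul_eq (x g : ℝ → ℝ) (s t L : ℝ) (hst : s ≤ t)
    (hg : IntervalIntegrable g volume s t)
    (hx : ∀ u ∈ Set.Icc s t, x u = x s + ∫ v in s..u, g v) :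
    Real.exp (L * t) * x t - Real.exp (L * s) * x s =
      ∫ u in s..t, Real.exp (L * u) * (g u + L * x u) := by
  set X : ℝ → ℝ := fun u => x s + ∫ v in s..u, g v with hX
  have hac1 : AbsolutelyContinuousOnInterval (fun u : ℝ => Real.exp (L * u)) s t :=
    ContDiffOn.absolutelyContinuousOnInterval (ContDiff.contDiffOn (by fun_prop))
  have hac2 : AbsolutelyContinuousOnInterval X s t := by
    have h1 : AbsolutelyContinuousOnInterval (fun _ : ℝ => x s) s t :=
      ContDiffOn.absolutelyContinuousOnInterval (ContDiff.contDiffOn (by fun_prop))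
    exact h1.add (hg.absolutelyContinuousOnInterval_intervalIntegral (by simp))
  have := hac1.integral_deriv_mul_eq_sub hac2
  rw [hx t ⟨hst, le_rfl⟩]
  have hs : X s = x s := by simp [hX]
  rw [hs] at this
  rw [← this]
  symm
  apply intervalIntegral.integral_congr_ae
  filter_upwards [hg.ae_hasDerivAt_integral] with u hu hus
  have hus' : u ∈ Set.uIcc s t := Set.uIoc_subset_uIcc hus
  have h1 := ((hu hus' s (by simp)).const_add (x s)).deriv
  have h2 : deriv (fun u : ℝ => Real.exp (L * u)) u = Real.exp (L * u) * L := by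
    have := (((hasDerivAt_id u).const_mul L).exp).deriv
    simpa using this
  rw [h2, hX, h1, hx u (by rwa [Set.uIcc_of_le hst] at hus')]
  ring

end ClassII

namespace ClassII
open scoped ENNReal

lemma meas_of_primitive (p f : ℝ → ℝ)
    (h : ∀ s t, 0 ≤ s → s ≤ t → p t = p s + ∫ u in s..t, f u) :
    AEMeasurable p (volume.restrict (Set.Ici 0)) := by
  classical
  set S : Set ℝ := {t | 0 ≤ t ∧ IntervalIntegrable f volume 0 t} with hS
  have hsubI : ∀ a b, 0 ≤ a → a ≤ b → IntervalIntegrable f volume 0 b →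
      IntervalIntegrable f volume 0 a := by
    intro a b ha hab hb
    apply hb.mono_set
    rw [Set.uIcc_of_le ha, Set.uIcc_of_le (ha.trans hab)]
    exact Set.Icc_subset_Icc_right hab
  have hord : S.OrdConnected := by
    refine ⟨fun a ha b hb c hc => ⟨ha.1.trans hc.1, hsubI c b (ha.1.trans hc.1) hc.2 hb.2⟩⟩
  have hcont0 : ∀ b ∈ S, ContinuousOn p (Set.Icc 0 b) := by
    intro b hb
    have h1 := intervalIntegral.continuousOn_primitive_interval' hb.2 (a := 0) (by simp)
    rw [Set.uIcc_of_le hb.1] at h1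
    exact (h1.const_add (p 0)).congr (fun t ht => h 0 t le_rfl ht.1)
  have hcont : ContinuousOn p S := by
    intro t ht
    by_cases hmax : ∃ b ∈ S, t < b
    · obtain ⟨b, hb, htb⟩ := hmax
      refine (hcont0 b hb t ⟨ht.1, htb.le⟩).mono_of_mem_nhdsWithin ?_
      filter_upwards [self_mem_nhdsWithin, mem_nhdsWithin_of_mem_nhds (Iio_mem_nhds htb)] with c hc hc2
      exact ⟨hc.1, le_of_lt hc2⟩
    · push Not at hmax
      exact (hcont0 t ht t ⟨ht.1, le_rfl⟩).mono (fun c hc => ⟨hc.1, hmax c hc⟩)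
  have hm : Measurable (S.piecewise p (fun _ => p 0)) :=
    ContinuousOn.measurable_piecewise hcont continuousOn_const hord.measurableSet
  refine ⟨_, hm, ?_⟩
  filter_upwards [ae_restrict_mem measurableSet_Ici] with t ht
  by_cases htS : t ∈ S
  · simp [htS]
  · have : ¬ IntervalIntegrable f volume 0 t := fun h => htS ⟨ht, h⟩
    rw [Set.piecewise_eq_of_notMem _ _ _ htS, h 0 t le_rfl ht,
      intervalIntegral.integral_undef this, add_zero]

lemma alg (l mu q x : ℕ → ℝ) (Lam : ℝ) (hmu0 : mu 0 = 0)
    (hx : ∀ k, x k = -∑ i ∈ Finset.range k, q i) (k : ℕ) :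
    -∑ i ∈ Finset.range k, (∑ j ∈ Finset.range i, l (i - j) * q j - (Lam + mu i) * q i
        + mu (i + 1) * q (i + 1)) =
      ∑ j ∈ Finset.range k, l (k - j) * x j - (Lam + mu k) * x k + mu k * x (k + 1) := by
  have hq : ∀ j, q j = x j - x (j + 1) := fun j => by
    rw [hx, hx, Finset.sum_range_succ]; ring
  have hx0 : x 0 = 0 := by simp [hx]
  induction k with
  | zero => simp [hx0, hmu0]
  | succ k ih =>
    rw [Finset.sum_range_succ, neg_add, ih, Finset.sum_range_succ' (fun j => l (k + 1 - j) * x j)]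
    simp only [Nat.add_sub_add_right, hx0, hq, mul_sub, Finset.sum_sub_distrib]
    ring

lemma row_tsum (lam mu : ℕ → ℝ → ℝ) (i : ℕ) (u : ℝ) (q : ℕ → ℝ) :
    ∑' j : ℕ, classIIMatrix lam mu i j u * q j =
      ∑ j ∈ Finset.range i, lam (i - j) u * q j
        - ((∑' k : ℕ, lam (k + 1) u) + mu i u) * q i + mu (i + 1) u * q (i + 1) := by
  rw [tsum_eq_sum (s := Finset.range (i + 2))]
  · rw [Finset.sum_range_succ, Finset.sum_range_succ]
    have : ∀ j ∈ Finset.range i, classIIMatrix lam mu i j u * q j = lam (i - j) u * q j := by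
      intro j hj
      have := Finset.mem_range.1 hj
      simp [classIIMatrix, Nat.succ_le_of_lt this]
    rw [Finset.sum_congr rfl this]
    simp [classIIMatrix]
    ring
  · intro j hj
    have : i + 2 ≤ j := by simpa using hj
    have h1 : ¬ (j + 1 ≤ i) := by omega
    have h2 : ¬ (i + 1 = j) := by omega
    have h3 : ¬ (i = j) := by omega
    simp only [classIIMatrix, h1, h2, h3, if_false, zero_mul]

/-- the uniformised matrix acting on tails -/
def cmat (lam mu : ℕ → ℝ → ℝ) (L : ℝ) (k j : ℕ) (u : ℝ) : ℝ :=
  if j < k then lam (k - j) u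
  else if j = k then L - (∑' i : ℕ, lam (i + 1) u) - mu (k + 1) u
  else if j = k + 1 then mu (k + 1) u
  else 0

lemma cmat_sum (lam mu : ℕ → ℝ → ℝ) (L : ℝ) (k : ℕ) (u : ℝ) (x : ℕ → ℝ) :
    ∑ j ∈ Finset.range (k + 2), cmat lam mu L k j u * x j =
      ∑ j ∈ Finset.range k, lam (k - j) u * x j
       + (L - (∑' i : ℕ, lam (i + 1) u) - mu (k + 1) u) * x k + mu (k + 1) u * x (k + 1) := by
  rw [Finset.sum_range_succ, Finset.sum_range_succ]
  have : ∀ j ∈ Finset.range k, cmat lam mu L k j u * x j = lam (k - j) u * x j := by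
    intro j hj
    simp [cmat, Finset.mem_range.1 hj]
  rw [Finset.sum_congr rfl this]
  simp [cmat]

lemma cmat_zero (lam mu : ℕ → ℝ → ℝ) (L : ℝ) (k j : ℕ) (u : ℝ) (h : j ∉ Finset.range (k + 2)) :
    cmat lam mu L k j u = 0 := by
  have : k + 2 ≤ j := by simpa using h
  have h1 : ¬ (j < k) := by omega
  have h2 : ¬ (j = k) := by omega
  have h3 : ¬ (j = k + 1) := by omega
  simp only [cmat, h1, h2, h3, if_false]

lemma cmat_nonneg (lam mu : ℕ → ℝ → ℝ) (L : ℝ) (u : ℝ)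
    (h1 : ∀ k, 0 ≤ lam k u) (h2 : ∀ k, 0 ≤ mu k u)
    (h3 : ∀ n, (∑' k : ℕ, lam (k + 1) u) + mu n u ≤ L) (k j : ℕ) :
    0 ≤ cmat lam mu L k j u := by
  unfold cmat
  split_ifs
  · exact h1 _
  · linarith [h3 (k + 1)]
  · exact h2 _
  · exact le_rfl

lemma cmat_row (lam mu : ℕ → ℝ → ℝ) (L : ℝ) (u : ℝ)
    (h1 : ∀ k, 0 ≤ lam k u) (h2 : ∀ k, 0 ≤ mu k u)
    (h3 : ∀ n, (∑' k : ℕ, lam (k + 1) u) + mu n u ≤ L)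
    (h4 : Summable (fun k : ℕ => lam (k + 1) u)) (k : ℕ) :
    ∑' j, ‖cmat lam mu L k j u‖ₑ ≤ ENNReal.ofReal L := by
  rw [tsum_eq_sum (s := Finset.range (k + 2)) (fun j hj => by
    rw [cmat_zero lam mu L k j u hj]; simp)]
  have : ∀ j, ‖cmat lam mu L k j u‖ₑ = ENNReal.ofReal (cmat lam mu L k j u) := fun j =>
    Real.enorm_of_nonneg (cmat_nonneg lam mu L u h1 h2 h3 k j)
  simp_rw [this]
  rw [← ENNReal.ofReal_sum_of_nonneg (fun j _ => cmat_nonneg lam mu L u h1 h2 h3 k j)]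
  apply ENNReal.ofReal_le_ofReal
  have h5 := cmat_sum lam mu L k u (fun _ => 1)
  simp only [mul_one] at h5
  rw [h5]
  have h6 : ∑ j ∈ Finset.range k, lam (k - j) u = ∑ j ∈ Finset.range k, lam (j + 1) u := by
    rw [← Finset.sum_range_reflect]
    apply Finset.sum_congr rfl
    intro j hj
    have := Finset.mem_range.1 hj
    congr 1
    omega
  have h7 := h4.sum_le_tsum (Finset.range k) (fun i _ => h1 (i + 1))
  rw [h6]
  linarith

lemma cmat_col (lam mu : ℕ → ℝ → ℝ) (L : ℝ) (u : ℝ) (d : ℕ → ℝ)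
    (hmu0 : mu 0 u = 0) (hdpos : ∀ k, 1 ≤ k → 0 < d k)
    (h4 : Summable (fun k : ℕ => lam (k + 1) u)) (j : ℕ)
    (h5 : Summable (fun i : ℕ => (d (i + 1 + (j + 1)) / d (j + 1)) * lam (i + 1) u)) :
    HasSum (fun k => d (k + 1) * cmat lam mu L k j u)
      ((L - alphaIIj d lam mu (j + 1) u) * d (j + 1)) := by
  have hdj := hdpos (j + 1) (by omega)
  rw [← hasSum_nat_add_iff' (j + 1)]
  have e1 : ∑ k ∈ Finset.range (j + 1), d (k + 1) * cmat lam mu L k j u =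
      d j * mu j u + d (j + 1) * (L - (∑' i : ℕ, lam (i + 1) u) - mu (j + 1) u) := by
    rw [Finset.sum_range_succ]
    congr 1
    · cases j with
      | zero => simp [hmu0]
      | succ j =>
        rw [Finset.sum_range_succ, Finset.sum_eq_zero]
        · simp [cmat]
        · intro k hk
          have hk' := Finset.mem_range.1 hk
          rw [cmat_zero _ _ _ _ _ _ (by simp; omega), mul_zero]
    · simp [cmat]
  have e2 : (L - alphaIIj d lam mu (j + 1) u) * d (j + 1)
      - ∑ k ∈ Finset.range (j + 1), d (k + 1) * cmat lam mu L k j u =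
      d (j + 1) * ∑' i : ℕ, (d (i + 1 + (j + 1)) / d (j + 1)) * lam (i + 1) u := by
    rw [e1]
    unfold alphaIIj
    have : ∑' i : ℕ, (1 - d (i + 1 + (j + 1)) / d (j + 1)) * lam (i + 1) u =
        ∑' i : ℕ, lam (i + 1) u -
          ∑' i : ℕ, (d (i + 1 + (j + 1)) / d (j + 1)) * lam (i + 1) u := by
      rw [← h4.tsum_sub h5]
      congr 1; ext i; ring
    rw [this]
    simp only [Nat.add_sub_cancel]
    field_simp
    ring
  rw [e2]
  have e3 : (fun n => d (n + (j + 1) + 1) * cmat lam mu L (n + (j + 1)) j u) = fun i =>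
      d (j + 1) * (d (i + 1 + (j + 1)) / d (j + 1) * lam (i + 1) u) := by
    funext i
    have h6 : j < i + (j + 1) := by omega
    have h7 : i + (j + 1) - j = i + 1 := by omega
    simp only [cmat, h6, if_true, h7]
    rw [show i + (j + 1) + 1 = i + 1 + (j + 1) by ring]
    field_simp
  rw [e3]
  exact h5.hasSum.mul_left (d (j + 1))

end ClassII

namespace ClassII
open scoped ENNReal

lemma sol_le_one {a : ℕ → ℕ → ℝ → ℝ} {p : ℝ → ℕ → ℝ} (hp : IsKolmogorovSolution a p)
    {t : ℝ} (ht : 0 ≤ t) (i : ℕ) : ‖p t i‖ ≤ 1 := by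
  obtain ⟨h0, h1⟩ := hp.1 t ht
  rw [Real.norm_of_nonneg (h0 i)]
  exact le_hasSum h1 i (fun j _ => h0 j)

lemma sol_meas {a : ℕ → ℕ → ℝ → ℝ} {p : ℝ → ℕ → ℝ} (hp : IsKolmogorovSolution a p) (i : ℕ) :
    AEMeasurable (fun t => p t i) (volume.restrict (Set.Ici 0)) :=
  meas_of_primitive _ _ (hp.2 i)

lemma Lam_meas (lam : ℕ → ℝ → ℝ) (hlamloc : ∀ k, LocallyIntegrableOn (lam k) (Set.Ici 0))
    (hlamsum : ∀ᵐ t : ℝ, 0 ≤ t → Summable (fun k : ℕ => lam (k + 1) t)) :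
    AEMeasurable (fun t => ∑' k : ℕ, lam (k + 1) t) (volume.restrict (Set.Ici 0)) := by
  refine aemeasurable_of_tendsto_metrizable_ae atTop
    (f := fun (n : ℕ) t => ∑ i ∈ Finset.range n, lam (i + 1) t) ?_ ?_
  · intro n
    exact Finset.aemeasurable_fun_sum _
      (fun i _ => (hlamloc (i + 1)).aestronglyMeasurable.aemeasurable)
  · rw [ae_restrict_iff' measurableSet_Ici]
    filter_upwards [hlamsum] with t ht ht0
    exact (ht ht0).hasSum.tendsto_sum_nat

lemma loc_int {f : ℝ → ℝ} (hf : LocallyIntegrableOn f (Set.Ici 0)) {s T : ℝ} (hs : 0 ≤ s) :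
    IntegrableOn f (Set.Ioc s T) :=
  (hf.integrableOn_compact_subset (fun _ hx => hs.trans hx.1 : Set.Icc s T ⊆ Set.Ici 0)
    isCompact_Icc).mono_set Set.Ioc_subset_Icc_self

lemma Lam_int (lam mu : ℕ → ℝ → ℝ) (L : ℝ)
    (hlampos : ∀ k, ∀ t : ℝ, 0 ≤ t → 0 ≤ lam k t)
    (hmu0 : ∀ t : ℝ, mu 0 t = 0)
    (hlamloc : ∀ k, LocallyIntegrableOn (lam k) (Set.Ici 0))
    (hlamsum : ∀ᵐ t : ℝ, 0 ≤ t → Summable (fun k : ℕ => lam (k + 1) t))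
    (hL : ∀ᵐ t : ℝ, 0 ≤ t → ∀ n, (∑' k : ℕ, lam (k + 1) t) + mu n t ≤ L)
    {s T : ℝ} (hs : 0 ≤ s) :
    IntegrableOn (fun t => ∑' k : ℕ, lam (k + 1) t) (Set.Ioc s T) := by
  have hsub : Set.Ioc s T ⊆ Set.Ici 0 := fun u hu => hs.trans hu.1.le
  refine Integrable.of_bound ((Lam_meas lam hlamloc hlamsum).mono_measure
    (Measure.restrict_mono hsub le_rfl)).aestronglyMeasurable L ?_
  rw [ae_restrict_iff' measurableSet_Ioc]
  filter_upwards [hL] with t ht hts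
  have h0 : 0 ≤ t := hsub hts
  rw [Real.norm_of_nonneg (tsum_nonneg fun k => hlampos _ _ h0)]
  have := ht h0 0
  rw [hmu0] at this
  linarith

/-- tail variables -/
def xt (p₁ p₂ : ℝ → ℕ → ℝ) (k : ℕ) (t : ℝ) : ℝ :=
  -∑ i ∈ Finset.range k, (p₁ t i - p₂ t i)

lemma xt_tail {a : ℕ → ℕ → ℝ → ℝ} {p₁ p₂ : ℝ → ℕ → ℝ} (hp₁ : IsKolmogorovSolution a p₁)
    (hp₂ : IsKolmogorovSolution a p₂) {t : ℝ} (ht : 0 ≤ t) (k : ℕ) :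
    ∑' i : ℕ, (p₁ t (k + i) - p₂ t (k + i)) = xt p₁ p₂ k t := by
  have h := (hp₁.1 t ht).2.sub (hp₂.1 t ht).2
  have h2 := h.summable.sum_add_tsum_nat_add k
  rw [h.tsum_eq] at h2
  unfold xt
  simp_rw [add_comm k]
  linarith

lemma xt_bound {a : ℕ → ℕ → ℝ → ℝ} {p₁ p₂ : ℝ → ℕ → ℝ} (hp₁ : IsKolmogorovSolution a p₁)
    (hp₂ : IsKolmogorovSolution a p₂) {t : ℝ} (ht : 0 ≤ t) (k : ℕ) :
    ‖xt p₁ p₂ k t‖ ≤ 1 := by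
  unfold xt
  rw [Finset.sum_sub_distrib, norm_neg, Real.norm_eq_abs, abs_le]
  obtain ⟨a0, a1⟩ := hp₁.1 t ht
  obtain ⟨b0, b1⟩ := hp₂.1 t ht
  have h1 := sum_le_hasSum (Finset.range k) (fun i _ => a0 i) a1
  have h2 := sum_le_hasSum (Finset.range k) (fun i _ => b0 i) b1
  have h3 := Finset.sum_nonneg (fun i (_ : i ∈ Finset.range k) => a0 i)
  have h4 := Finset.sum_nonneg (fun i (_ : i ∈ Finset.range k) => b0 i)
  constructor <;> linarith

/-- right-hand side of the equation for the tails -/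
def gt (lam mu : ℕ → ℝ → ℝ) (p₁ p₂ : ℝ → ℕ → ℝ) (k : ℕ) (u : ℝ) : ℝ :=
  ∑ j ∈ Finset.range k, lam (k - j) u * xt p₁ p₂ j u
    - ((∑' i : ℕ, lam (i + 1) u) + mu k u) * xt p₁ p₂ k u + mu k u * xt p₁ p₂ (k + 1) u

lemma gt_succ (lam mu : ℕ → ℝ → ℝ) (p₁ p₂ : ℝ → ℕ → ℝ) (L : ℝ) (k : ℕ) (u : ℝ) :
    gt lam mu p₁ p₂ (k + 1) u + L * xt p₁ p₂ (k + 1) u =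
      ∑ j ∈ Finset.range (k + 2), cmat lam mu L k j u * xt p₁ p₂ (j + 1) u := by
  rw [cmat_sum lam mu L k u (fun j => xt p₁ p₂ (j + 1) u)]
  unfold gt
  rw [Finset.sum_range_succ']
  have : xt p₁ p₂ 0 u = 0 := by simp [xt]
  simp only [Nat.add_sub_add_right, this]
  ring

lemma bdd_int {c f : ℝ → ℝ} {s T K : ℝ} (hs : 0 ≤ s) (hc : IntegrableOn c (Set.Ioc s T))
    (hf : AEMeasurable f (volume.restrict (Set.Ici 0))) (hb : ∀ t, 0 ≤ t → ‖f t‖ ≤ K) :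
    IntegrableOn (fun u => c u * f u) (Set.Ioc s T) := by
  have hsub : Set.Ioc s T ⊆ Set.Ici 0 := fun u hu => hs.trans hu.1.le
  refine Integrable.mul_bdd (c := K) hc
    (hf.mono_measure (Measure.restrict_mono hsub le_rfl)).aestronglyMeasurable ?_
  filter_upwards [ae_restrict_mem measurableSet_Ioc] with t ht
  exact hb t (hsub ht)

lemma row_int (lam mu : ℕ → ℝ → ℝ) (L : ℝ)
    (hlampos : ∀ k, ∀ t : ℝ, 0 ≤ t → 0 ≤ lam k t)
    (hmu0 : ∀ t : ℝ, mu 0 t = 0)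
    (hlamloc : ∀ k, LocallyIntegrableOn (lam k) (Set.Ici 0))
    (hmuloc : ∀ n, LocallyIntegrableOn (mu n) (Set.Ici 0))
    (hlamsum : ∀ᵐ t : ℝ, 0 ≤ t → Summable (fun k : ℕ => lam (k + 1) t))
    (hL : ∀ᵐ t : ℝ, 0 ≤ t → ∀ n, (∑' k : ℕ, lam (k + 1) t) + mu n t ≤ L)
    {s T K : ℝ} (hs : 0 ≤ s) (i : ℕ) (q : ℝ → ℕ → ℝ)
    (hq : ∀ j, AEMeasurable (fun t => q t j) (volume.restrict (Set.Ici 0)))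
    (hb : ∀ t, 0 ≤ t → ∀ j, ‖q t j‖ ≤ K) (k l : ℕ) :
    IntegrableOn (fun u => ∑ j ∈ Finset.range i, lam (i - j) u * q u j
        - ((∑' k : ℕ, lam (k + 1) u) + mu k u) * q u i + mu l u * q u (i + 1)) (Set.Ioc s T) := by
  have hΛ := Lam_int lam mu L hlampos hmu0 hlamloc hlamsum hL (s := s) (T := T) hs
  refine Integrable.add (Integrable.sub ?_ ?_) ?_
  · exact integrable_finsetSum _ (fun j _ =>
      bdd_int hs (loc_int (hlamloc _) hs) (hq j) (fun t ht => hb t ht j))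
  · exact bdd_int hs (hΛ.add (loc_int (hmuloc _) hs)) (hq i) (fun t ht => hb t ht i)
  · exact bdd_int hs (loc_int (hmuloc _) hs) (hq _) (fun t ht => hb t ht _)

lemma xt_meas {a : ℕ → ℕ → ℝ → ℝ} {p₁ p₂ : ℝ → ℕ → ℝ} (hp₁ : IsKolmogorovSolution a p₁)
    (hp₂ : IsKolmogorovSolution a p₂) (k : ℕ) :
    AEMeasurable (fun t => xt p₁ p₂ k t) (volume.restrict (Set.Ici 0)) :=
  (Finset.aemeasurable_fun_sum _ (fun i _ => (sol_meas hp₁ i).sub (sol_meas hp₂ i))).neg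

lemma gt_int (lam mu : ℕ → ℝ → ℝ) (L : ℝ)
    (hlampos : ∀ k, ∀ t : ℝ, 0 ≤ t → 0 ≤ lam k t)
    (hmu0 : ∀ t : ℝ, mu 0 t = 0)
    (hlamloc : ∀ k, LocallyIntegrableOn (lam k) (Set.Ici 0))
    (hmuloc : ∀ n, LocallyIntegrableOn (mu n) (Set.Ici 0))
    (hlamsum : ∀ᵐ t : ℝ, 0 ≤ t → Summable (fun k : ℕ => lam (k + 1) t))
    (hL : ∀ᵐ t : ℝ, 0 ≤ t → ∀ n, (∑' k : ℕ, lam (k + 1) t) + mu n t ≤ L)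
    {p₁ p₂ : ℝ → ℕ → ℝ} (hp₁ : IsKolmogorovSolution (classIIMatrix lam mu) p₁)
    (hp₂ : IsKolmogorovSolution (classIIMatrix lam mu) p₂) {s T : ℝ} (hs : 0 ≤ s) (k : ℕ) :
    IntegrableOn (gt lam mu p₁ p₂ k) (Set.Ioc s T) :=
  row_int lam mu L hlampos hmu0 hlamloc hmuloc hlamsum hL hs k (fun t j => xt p₁ p₂ j t)
    (xt_meas hp₁ hp₂) (fun t ht j => xt_bound hp₁ hp₂ ht j) k k

lemma sol_int (lam mu : ℕ → ℝ → ℝ) (L : ℝ)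
    (hlampos : ∀ k, ∀ t : ℝ, 0 ≤ t → 0 ≤ lam k t)
    (hmu0 : ∀ t : ℝ, mu 0 t = 0)
    (hlamloc : ∀ k, LocallyIntegrableOn (lam k) (Set.Ici 0))
    (hmuloc : ∀ n, LocallyIntegrableOn (mu n) (Set.Ici 0))
    (hlamsum : ∀ᵐ t : ℝ, 0 ≤ t → Summable (fun k : ℕ => lam (k + 1) t))
    (hL : ∀ᵐ t : ℝ, 0 ≤ t → ∀ n, (∑' k : ℕ, lam (k + 1) t) + mu n t ≤ L)
    {p : ℝ → ℕ → ℝ} (hp : IsKolmogorovSolution (classIIMatrix lam mu) p)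
    {s T : ℝ} (hs : 0 ≤ s) (i : ℕ) :
    IntegrableOn (fun u => ∑' j : ℕ, classIIMatrix lam mu i j u * p u j) (Set.Ioc s T) := by
  simp_rw [row_tsum]
  exact row_int lam mu L hlampos hmu0 hlamloc hmuloc hlamsum hL hs i p
    (sol_meas hp) (fun t ht j => sol_le_one hp ht j) i (i + 1)

lemma xt_eq (lam mu : ℕ → ℝ → ℝ) (L : ℝ)
    (hlampos : ∀ k, ∀ t : ℝ, 0 ≤ t → 0 ≤ lam k t)
    (hmu0 : ∀ t : ℝ, mu 0 t = 0)
    (hlamloc : ∀ k, LocallyIntegrableOn (lam k) (Set.Ici 0))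
    (hmuloc : ∀ n, LocallyIntegrableOn (mu n) (Set.Ici 0))
    (hlamsum : ∀ᵐ t : ℝ, 0 ≤ t → Summable (fun k : ℕ => lam (k + 1) t))
    (hL : ∀ᵐ t : ℝ, 0 ≤ t → ∀ n, (∑' k : ℕ, lam (k + 1) t) + mu n t ≤ L)
    {p₁ p₂ : ℝ → ℕ → ℝ} (hp₁ : IsKolmogorovSolution (classIIMatrix lam mu) p₁)
    (hp₂ : IsKolmogorovSolution (classIIMatrix lam mu) p₂) {s t : ℝ} (hs : 0 ≤ s) (hst : s ≤ t)
    (k : ℕ) :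
    xt p₁ p₂ k t = xt p₁ p₂ k s + ∫ u in s..t, gt lam mu p₁ p₂ k u := by
  have hi₁ : ∀ i, IntervalIntegrable (fun u => ∑' j : ℕ, classIIMatrix lam mu i j u * p₁ u j)
      volume s t := fun i => (intervalIntegrable_iff_integrableOn_Ioc_of_le hst).2
    (sol_int lam mu L hlampos hmu0 hlamloc hmuloc hlamsum hL hp₁ hs i)
  have hi₂ : ∀ i, IntervalIntegrable (fun u => ∑' j : ℕ, classIIMatrix lam mu i j u * p₂ u j)
      volume s t := fun i => (intervalIntegrable_iff_integrableOn_Ioc_of_le hst).2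
    (sol_int lam mu L hlampos hmu0 hlamloc hmuloc hlamsum hL hp₂ hs i)
  have hg : ∀ u, gt lam mu p₁ p₂ k u = -∑ i ∈ Finset.range k,
      (∑' j : ℕ, classIIMatrix lam mu i j u * p₁ u j
        - ∑' j : ℕ, classIIMatrix lam mu i j u * p₂ u j) := by
    intro u
    have := alg (fun j => lam j u) (fun j => mu j u) (fun j => p₁ u j - p₂ u j)
      (fun k => xt p₁ p₂ k u) (∑' i : ℕ, lam (i + 1) u) (hmu0 u) (fun k => rfl) k
    unfold gt
    rw [← this]
    congr 1
    apply Finset.sum_congr rfl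
    intro i _
    rw [row_tsum, row_tsum]
    simp only [mul_sub, Finset.sum_sub_distrib]
    ring
  simp_rw [hg]
  rw [intervalIntegral.integral_neg, intervalIntegral.integral_finsetSum
    (fun i _ => (hi₁ i).sub (hi₂ i))]
  unfold xt
  rw [← neg_add, ← Finset.sum_add_distrib]
  congr 1
  apply Finset.sum_congr rfl
  intro i _
  rw [intervalIntegral.integral_sub (hi₁ i) (hi₂ i), hp₁.2 i s t hs hst, hp₂.2 i s t hs hst]
  ring

lemma cmat_meas (lam mu : ℕ → ℝ → ℝ) (L : ℝ)
    (hlamloc : ∀ k, LocallyIntegrableOn (lam k) (Set.Ici 0))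
    (hmuloc : ∀ n, LocallyIntegrableOn (mu n) (Set.Ici 0))
    (hlamsum : ∀ᵐ t : ℝ, 0 ≤ t → Summable (fun k : ℕ => lam (k + 1) t))
    (k j : ℕ) :
    AEMeasurable (cmat lam mu L k j) (volume.restrict (Set.Ici 0)) := by
  have h1 := Lam_meas lam hlamloc hlamsum
  have h2 := fun k => (hlamloc k).aestronglyMeasurable.aemeasurable
  have h3 := fun k => (hmuloc k).aestronglyMeasurable.aemeasurable
  unfold cmat
  split_ifs
  · exact h2 _
  · exact (aemeasurable_const.sub h1).sub (h3 _)
  · exact h3 _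
  · exact aemeasurable_const

lemma m_ineq (lam mu : ℕ → ℝ → ℝ) (L : ℝ)
    (hlampos : ∀ k, ∀ t : ℝ, 0 ≤ t → 0 ≤ lam k t)
    (hmu0 : ∀ t : ℝ, mu 0 t = 0)
    (hlamloc : ∀ k, LocallyIntegrableOn (lam k) (Set.Ici 0))
    (hmuloc : ∀ n, LocallyIntegrableOn (mu n) (Set.Ici 0))
    (hlamsum : ∀ᵐ t : ℝ, 0 ≤ t → Summable (fun k : ℕ => lam (k + 1) t))
    (hL : ∀ᵐ t : ℝ, 0 ≤ t → ∀ n, (∑' k : ℕ, lam (k + 1) t) + mu n t ≤ L)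
    {p₁ p₂ : ℝ → ℕ → ℝ} (hp₁ : IsKolmogorovSolution (classIIMatrix lam mu) p₁)
    (hp₂ : IsKolmogorovSolution (classIIMatrix lam mu) p₂) {s t : ℝ} (hs : 0 ≤ s) (hst : s ≤ t)
    (k : ℕ) :
    ‖Real.exp (L * t) * xt p₁ p₂ (k + 1) t‖ₑ ≤ ‖Real.exp (L * s) * xt p₁ p₂ (k + 1) s‖ₑ +
      ∫⁻ u in Set.Ioc s t, ∑' j, ‖cmat lam mu L k j u‖ₑ *
        ‖Real.exp (L * u) * xt p₁ p₂ (j + 1) u‖ₑ := by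
  have h := exp_mul_eq (xt p₁ p₂ (k + 1)) (gt lam mu p₁ p₂ (k + 1)) s t L hst
    ((intervalIntegrable_iff_integrableOn_Ioc_of_le hst).2
      (gt_int lam mu L hlampos hmu0 hlamloc hmuloc hlamsum hL hp₁ hp₂ hs (k + 1)))
    (fun u hu => xt_eq lam mu L hlampos hmu0 hlamloc hmuloc hlamsum hL hp₁ hp₂ hs hu.1 (k + 1))
  rw [sub_eq_iff_eq_add'] at h
  rw [h]
  refine (enorm_add_le _ _).trans ?_
  gcongr
  rw [intervalIntegral.integral_of_le hst]
  refine (enorm_integral_le_lintegral_enorm _).trans ?_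
  apply lintegral_mono
  intro u
  dsimp only
  rw [gt_succ, Finset.mul_sum]
  refine (enorm_sum_le _ _).trans ?_
  refine le_trans ?_ (ENNReal.sum_le_tsum (Finset.range (k + 2)))
  apply le_of_eq
  apply Finset.sum_congr rfl
  intro j _
  rw [← enorm_mul]
  congr 1
  ring

theorem main_bound (lam mu : ℕ → ℝ → ℝ) (L : ℝ)
    (hlampos : ∀ k, ∀ t : ℝ, 0 ≤ t → 0 ≤ lam k t)
    (hmupos : ∀ n, ∀ t : ℝ, 0 ≤ t → 0 ≤ mu n t)
    (hmu0 : ∀ t : ℝ, mu 0 t = 0)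
    (hlamloc : ∀ k, LocallyIntegrableOn (lam k) (Set.Ici 0))
    (hmuloc : ∀ n, LocallyIntegrableOn (mu n) (Set.Ici 0))
    (hlamsum : ∀ᵐ t : ℝ, 0 ≤ t → Summable (fun k : ℕ => lam (k + 1) t))
    (hL : ∀ᵐ t : ℝ, 0 ≤ t → ∀ n, (∑' k : ℕ, lam (k + 1) t) + mu n t ≤ L)
    (hL0 : 0 ≤ L)
    (d : ℕ → ℝ) (hd1 : d 1 = 1) (hdpos : ∀ k, 1 ≤ k → 0 < d k)
    (hdmono : ∀ k, 1 ≤ k → d k ≤ d (k + 1))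
    (hsumfin : ∀ᵐ t : ℝ, 0 ≤ t → ∀ j, 1 ≤ j →
      Summable (fun i : ℕ => (d (i + 1 + j) / d j) * lam (i + 1) t))
    (hαfin : ∀ᵐ t : ℝ, 0 ≤ t →
      BddBelow (Set.range fun j : ℕ => alphaIIj d lam mu (j + 1) t))
    (hαloc : LocallyIntegrableOn (alphaII d lam mu) (Set.Ici 0))
    (p₁ p₂ : ℝ → ℕ → ℝ)
    (hp₁ : IsKolmogorovSolution (classIIMatrix lam mu) p₁)
    (hp₂ : IsKolmogorovSolution (classIIMatrix lam mu) p₂)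
    (s T : ℝ) (hs : 0 ≤ s) (hsT : s ≤ T)
    (hfin : Norm1DFinite d (fun k => p₁ s k - p₂ s k)) :
    (∑' k : ℕ, |p₁ T k - p₂ T k|) ≤
        4 * Real.exp (-∫ u in s..T, alphaII d lam mu u) *
          norm1D d (fun k => p₁ s k - p₂ s k) := by
  have hsub : Set.Ioc s T ⊆ Set.Ici 0 := fun u hu => hs.trans hu.1.le
  have hν : volume.restrict (Set.Ioc s T) ≤ volume.restrict (Set.Ici (0 : ℝ)) :=
    Measure.restrict_mono hsub le_rfl
  have hT : 0 ≤ T := hs.trans hsT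
  set N := norm1D d (fun k => p₁ s k - p₂ s k) with hN
  have hd1' : ∀ k, 1 ≤ d (k + 1) := by
    intro k
    induction k with
    | zero => simp [hd1]
    | succ k ih => exact ih.trans (hdmono _ (by omega))
  have hd0 : ∀ k, 0 ≤ d (k + 1) := fun k => (hdpos _ (by omega)).le
  -- the initial norm
  have hfin' : Summable (fun k => d (k + 1) * |xt p₁ p₂ (k + 1) s|) := by
    unfold Norm1DFinite at hfin
    simp_rw [xt_tail hp₁ hp₂ hs] at hfin
    exact hfin
  have hN' : N = ∑' k, d (k + 1) * |xt p₁ p₂ (k + 1) s| := by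
    rw [hN]
    unfold norm1D
    simp_rw [xt_tail hp₁ hp₂ hs]
  have hN0 : 0 ≤ N := by
    rw [hN']; exact tsum_nonneg (fun k => mul_nonneg (hd0 k) (abs_nonneg _))
  have hV : ∑' k, ENNReal.ofReal (d (k + 1)) * ‖Real.exp (L * s) * xt p₁ p₂ (k + 1) s‖ₑ =
      ENNReal.ofReal (Real.exp (L * s) * N) := by
    rw [hN', ← tsum_mul_left, ENNReal.ofReal_tsum_of_nonneg
      (fun k => mul_nonneg (Real.exp_nonneg _) (mul_nonneg (hd0 k) (abs_nonneg _)))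
      (hfin'.mul_left _)]
    congr 1; ext k
    rw [Real.enorm_eq_ofReal_abs, ← ENNReal.ofReal_mul (hd0 k), abs_mul, Real.abs_exp]
    congr 1; ring
  -- pointwise a.e. facts
  have hae : ∀ᵐ u ∂(volume.restrict (Set.Ioc s T)),
      (∀ k, ∑' j, ‖cmat lam mu L k j u‖ₑ ≤ ENNReal.ofReal L) ∧
      (∀ j, ∑' k, ENNReal.ofReal (d (k + 1)) * ‖cmat lam mu L k j u‖ₑ ≤
        ENNReal.ofReal (L - alphaII d lam mu u) * ENNReal.ofReal (d (j + 1))) ∧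
      0 ≤ L - alphaII d lam mu u := by
    rw [ae_restrict_iff' measurableSet_Ioc]
    filter_upwards [hlamsum, hL, hsumfin, hαfin] with u h1 h2 h3 h4 hu
    have hu0 : 0 ≤ u := hsub hu
    have hcn := cmat_nonneg lam mu L u (fun k => hlampos k u hu0) (fun k => hmupos k u hu0)
      (h2 hu0)
    have hcol := fun j => cmat_col lam mu L u d (hmu0 u) hdpos (h1 hu0) j
      (h3 hu0 (j + 1) (by omega))
    have hα : ∀ j, alphaII d lam mu u ≤ alphaIIj d lam mu (j + 1) u := fun j =>
      ciInf_le (h4 hu0) j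
    have hpos : 0 ≤ L - alphaII d lam mu u := by
      have h5 := (hcol 0).nonneg (fun k => mul_nonneg (hd0 k) (hcn k 0))
      have h6 := hα 0
      simp only [zero_add, hd1, mul_one] at h5 h6
      linarith
    refine ⟨cmat_row lam mu L u (fun k => hlampos k u hu0) (fun k => hmupos k u hu0)
      (h2 hu0) (h1 hu0), fun j => ?_, hpos⟩
    have e : ∀ k, ENNReal.ofReal (d (k + 1)) * ‖cmat lam mu L k j u‖ₑ =
        ENNReal.ofReal (d (k + 1) * cmat lam mu L k j u) := fun k => by
      rw [Real.enorm_of_nonneg (hcn k j), ENNReal.ofReal_mul (hd0 k)]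
    simp_rw [e]
    rw [← ENNReal.ofReal_tsum_of_nonneg (fun k => mul_nonneg (hd0 k) (hcn k j))
      (hcol j).summable, (hcol j).tsum_eq, ← ENNReal.ofReal_mul hpos]
    apply ENNReal.ofReal_le_ofReal
    exact mul_le_mul_of_nonneg_right (by linarith [hα j]) (hd0 j)
  have hαi : IntervalIntegrable (alphaII d lam mu) volume s T :=
    (intervalIntegrable_iff_integrableOn_Ioc_of_le hsT).2 (loc_int hαloc hs)
  have hhi : IntervalIntegrable (fun u => L - alphaII d lam mu u) volume s T :=
    intervalIntegrable_const.sub hαi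
  have hcore := core (fun k t => ‖Real.exp (L * t) * xt p₁ p₂ (k + 1) t‖ₑ)
    (fun k j u => ‖cmat lam mu L k j u‖ₑ) (fun k => ENNReal.ofReal (d (k + 1))) s T L
    (Real.exp (L * T)) hsT hL0 (Real.exp_nonneg _) (fun k => ENNReal.ofReal_ne_top)
    (fun k j => ((cmat_meas lam mu L hlamloc hmuloc hlamsum k j).mono_measure hν).enorm)
    (fun u => ENNReal.ofReal (L - alphaII d lam mu u))
    (fun t => ENNReal.ofReal (Real.exp (L * s) * N *
      Real.exp (∫ v in s..t, (L - alphaII d lam mu v))))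
    (hae.mono fun u hu => hu.1) (hae.mono fun u hu => hu.2.1)
    (fun k t ht => m_ineq lam mu L hlampos hmu0 hlamloc hmuloc hlamsum hL hp₁ hp₂ hs ht.1 k)
    (fun k t ht => by
      rw [Real.enorm_eq_ofReal_abs, abs_mul, Real.abs_exp]
      apply ENNReal.ofReal_le_ofReal
      have h1 := xt_bound hp₁ hp₂ (hs.trans ht.1) (k + 1)
      rw [Real.norm_eq_abs] at h1
      have h2 : Real.exp (L * t) ≤ Real.exp (L * T) :=
        Real.exp_le_exp.2 (mul_le_mul_of_nonneg_left ht.2 hL0)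
      calc _ ≤ Real.exp (L * t) * 1 := by gcongr
        _ ≤ _ := by rw [mul_one]; exact h2)
    (fun t ht => by
      rw [hV]
      exact exp_gronwall _ s T _ (mul_nonneg (Real.exp_nonneg _) hN0) hhi
        (hae.mono fun u hu => hu.2.2) t ht)
  rw [intervalIntegral.integral_sub intervalIntegrable_const hαi,
    intervalIntegral.integral_const, smul_eq_mul] at hcore
  -- conclusion
  have hq : ∀ k, p₁ T k - p₂ T k = xt p₁ p₂ k T - xt p₁ p₂ (k + 1) T := fun k => by
    unfold xt; rw [Finset.sum_range_succ]; ring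
  have hx0 : xt p₁ p₂ 0 T = 0 := by simp [xt]
  have hsumq : Summable (fun k => |p₁ T k - p₂ T k|) :=
    ((hp₁.1 T hT).2.summable.sub (hp₂.1 T hT).2.summable).abs
  have hR : 0 ≤ Real.exp (-∫ u in s..T, alphaII d lam mu u) * N :=
    mul_nonneg (Real.exp_nonneg _) hN0
  have hxs : ∑' k, ‖xt p₁ p₂ (k + 1) T‖ₑ ≤
      ENNReal.ofReal (Real.exp (-∫ u in s..T, alphaII d lam mu u) * N) := by
    calc ∑' k, ‖xt p₁ p₂ (k + 1) T‖ₑ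
        ≤ ∑' k, ENNReal.ofReal (Real.exp (-(L * T))) * (ENNReal.ofReal (d (k + 1)) *
          ‖Real.exp (L * T) * xt p₁ p₂ (k + 1) T‖ₑ) := by
          gcongr with k
          rw [Real.enorm_eq_ofReal_abs, Real.enorm_eq_ofReal_abs, ← ENNReal.ofReal_mul (hd0 k),
            ← ENNReal.ofReal_mul (Real.exp_nonneg _), abs_mul, Real.abs_exp]
          apply ENNReal.ofReal_le_ofReal
          have h1 : Real.exp (-(L * T)) * (d (k + 1) * (Real.exp (L * T) *
              |xt p₁ p₂ (k + 1) T|)) = d (k + 1) * |xt p₁ p₂ (k + 1) T| := by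
            have : Real.exp (-(L * T)) * Real.exp (L * T) = 1 := by
              rw [← Real.exp_add]; simp
            linear_combination (d (k + 1) * |xt p₁ p₂ (k + 1) T|) * this
          rw [h1]
          nlinarith [hd1' k, abs_nonneg (xt p₁ p₂ (k + 1) T)]
      _ = ENNReal.ofReal (Real.exp (-(L * T))) * ∑' k, (ENNReal.ofReal (d (k + 1)) *
          ‖Real.exp (L * T) * xt p₁ p₂ (k + 1) T‖ₑ) := ENNReal.tsum_mul_left
      _ ≤ _ := by
          refine (mul_le_mul_right hcore _).trans ?_
          rw [← ENNReal.ofReal_mul (Real.exp_nonneg _)]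
          apply ENNReal.ofReal_le_ofReal
          apply le_of_eq
          rw [show Real.exp (-∫ u in s..T, alphaII d lam mu u) = Real.exp (-(L * T)) *
            Real.exp (L * s) * Real.exp ((T - s) * L - ∫ u in s..T, alphaII d lam mu u) by
              rw [← Real.exp_add, ← Real.exp_add]; congr 1; ring]
          ring
  have hfinal : ENNReal.ofReal (∑' k : ℕ, |p₁ T k - p₂ T k|) ≤
      ENNReal.ofReal (2 * (Real.exp (-∫ u in s..T, alphaII d lam mu u) * N)) := by
    rw [ENNReal.ofReal_tsum_of_nonneg (fun k => abs_nonneg _) hsumq]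
    calc ∑' k, ENNReal.ofReal |p₁ T k - p₂ T k|
        ≤ ∑' k, (‖xt p₁ p₂ k T‖ₑ + ‖xt p₁ p₂ (k + 1) T‖ₑ) := by
          gcongr with k
          rw [← Real.enorm_eq_ofReal_abs, hq]
          exact enorm_sub_le
      _ = ∑' k, ‖xt p₁ p₂ (k + 1) T‖ₑ + ∑' k, ‖xt p₁ p₂ (k + 1) T‖ₑ := by
          rw [ENNReal.tsum_add, tsum_eq_zero_add' ENNReal.summable, hx0]
          simp
      _ ≤ _ := by
          rw [two_mul, ENNReal.ofReal_add hR hR]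
          gcongr
  rw [ENNReal.ofReal_le_ofReal_iff (by positivity)] at hfinal
  linarith

end ClassII

/-- ergodicity bound for the inhomogeneous queue with batch arrivals and
state-dependent single services, class II.  For any two solutions `p*`, `p**` of the
forward Kolmogorov system and any `0 ≤ s ≤ t` with `‖z*(s) − z**(s)‖_{1D} < ∞`,
`‖p*(t) − p**(t)‖ ≤ 4·exp(−∫_s^t α(u) du)·‖z*(s) − z**(s)‖_{1D}`; consequently, if
`∫_0^∞ α(t) dt = +∞` then `‖p*(t) − p**(t)‖ → 0` as `t → ∞` (weak ergodicity). -/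
theorem classII_ergodicity_bound
    (lam mu : ℕ → ℝ → ℝ) (L : ℝ)
    (hlampos : ∀ k, ∀ t : ℝ, 0 ≤ t → 0 ≤ lam k t)
    (hmupos : ∀ n, ∀ t : ℝ, 0 ≤ t → 0 ≤ mu n t)
    (hmu0 : ∀ t : ℝ, mu 0 t = 0)
    (hlamloc : ∀ k, LocallyIntegrableOn (lam k) (Set.Ici 0))
    (hmuloc : ∀ n, LocallyIntegrableOn (mu n) (Set.Ici 0))
    (hlamsum : ∀ᵐ t : ℝ, 0 ≤ t → Summable (fun k : ℕ => lam (k + 1) t))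
    (hL : ∀ᵐ t : ℝ, 0 ≤ t → ∀ n, (∑' k : ℕ, lam (k + 1) t) + mu n t ≤ L)
    (d : ℕ → ℝ) (hd1 : d 1 = 1) (hdpos : ∀ k, 1 ≤ k → 0 < d k)
    (hdmono : ∀ k, 1 ≤ k → d k ≤ d (k + 1))
    (hsumfin : ∀ᵐ t : ℝ, 0 ≤ t → ∀ j, 1 ≤ j →
      Summable (fun i : ℕ => (d (i + 1 + j) / d j) * lam (i + 1) t))
    (hαfin : ∀ᵐ t : ℝ, 0 ≤ t →
      BddBelow (Set.range fun j : ℕ => alphaIIj d lam mu (j + 1) t))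
    (hαloc : LocallyIntegrableOn (alphaII d lam mu) (Set.Ici 0))
    (p₁ p₂ : ℝ → ℕ → ℝ)
    (hp₁ : IsKolmogorovSolution (classIIMatrix lam mu) p₁)
    (hp₂ : IsKolmogorovSolution (classIIMatrix lam mu) p₂)
    (hfin0 : Norm1DFinite d (fun k => p₁ 0 k - p₂ 0 k)) :
    (∀ s t : ℝ, 0 ≤ s → s ≤ t →
      Norm1DFinite d (fun k => p₁ s k - p₂ s k) →
      (∑' k : ℕ, |p₁ t k - p₂ t k|) ≤
        4 * Real.exp (-∫ u in s..t, alphaII d lam mu u) *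
          norm1D d (fun k => p₁ s k - p₂ s k)) ∧
    (Tendsto (fun T : ℝ => ∫ u in (0 : ℝ)..T, alphaII d lam mu u) atTop atTop →
      Tendsto (fun t : ℝ => ∑' k : ℕ, |p₁ t k - p₂ t k|) atTop (𝓝 0)) := by
  have hbound : ∀ s t : ℝ, 0 ≤ s → s ≤ t →
      Norm1DFinite d (fun k => p₁ s k - p₂ s k) →
      (∑' k : ℕ, |p₁ t k - p₂ t k|) ≤
        4 * Real.exp (-∫ u in s..t, alphaII d lam mu u) *
          norm1D d (fun k => p₁ s k - p₂ s k) := by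
    intro s t hs hst hfin
    exact ClassII.main_bound lam mu (max L 0) hlampos hmupos hmu0 hlamloc hmuloc hlamsum
      (hL.mono fun t ht h0 n => (ht h0 n).trans (le_max_left _ _)) (le_max_right _ _)
      d hd1 hdpos hdmono hsumfin hαfin hαloc p₁ p₂ hp₁ hp₂ s t hs hst hfin
  refine ⟨hbound, fun hα => ?_⟩
  have hlim : Tendsto (fun t : ℝ => 4 * Real.exp (-∫ u in (0 : ℝ)..t, alphaII d lam mu u) *
      norm1D d (fun k => p₁ 0 k - p₂ 0 k)) atTop (𝓝 0) := by
    have := ((Real.tendsto_exp_neg_atTop_nhds_zero.comp hα).const_mul 4).mul_const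
      (norm1D d (fun k => p₁ 0 k - p₂ 0 k))
    simpa using this
  refine tendsto_of_tendsto_of_tendsto_of_le_of_le' tendsto_const_nhds hlim
    (Eventually.of_forall fun t => tsum_nonneg fun k => abs_nonneg _) ?_
  filter_upwards [eventually_ge_atTop (0 : ℝ)] with t ht
  exact hbound 0 t le_rfl ht hfin0
end
end

section
/- (Ergodicity bound for the inhomogeneous queue with batch arrivals and batch service, class IV.) Assume that for almost every t the sequence k ↦ μ_k(t) is nonincreasing in k (this guarantees that the transformed matrix D B(t) D⁻¹ has nonnegative off-diagonal entries). Then for any two solutions p*, p** of the forward Kolmogorov system and any 0 ≤ s ≤ t with ‖z*(s) − z**(s)‖_{1D} < ∞, one has ‖p*(t) − p**(t)‖ ≤ 4·exp(−∫_s^t α(u) du)·‖z*(s) − z**(s)‖_{1D}, where α(t) = inf_{i≥1} α_i(t) and α_i(t) = Σ_{k=1}^{i} μ_k(t) + Σ_{k≥1} λ_k(t) − Σ_{k=1}^{i−1} (μ_{i−k}(t) − μ_i(t))·d_k/d_i − Σ_{k≥1} λ_k(t)·d_{k+i}/d_i. Consequently, if ∫_0^∞ α(t) dt = +∞, then ‖p*(t)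 − p**(t)‖ → 0 as t → ∞ (the chain is weakly ergodic). -/
open MeasureTheory intervalIntegral Filter
open scoped Topology

noncomputable section

/-- The transposed intensity matrix of the queue with batch arrivals of size `k ≥ 1` at
intensity `λ_k(t)` and batch services of groups of `k` customers at intensity `μ_k(t)`:
`a_{j+k,j}(t) = λ_k(t)` for `k ≥ 1`, `a_{j−k,j}(t) = μ_k(t)` for `1 ≤ k ≤ j`,
`a_{jj}(t) = −(Σ_{k≥1} λ_k(t) + Σ_{k=1}^j μ_k(t))`. -/
def classIVMatrix (lam mu : ℕ → ℝ → ℝ) (i j : ℕ) (t : ℝ) : ℝ :=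
  if j + 1 ≤ i then lam (i - j) t
  else if i < j then mu (j - i) t
  else if i = j then -((∑' k : ℕ, lam (k + 1) t) + ∑ k ∈ Finset.Icc 1 j, mu k t)
  else 0

/-- `α_i(t) = Σ_{k=1}^i μ_k(t) + Σ_{k≥1} λ_k(t)
  − Σ_{k=1}^{i−1}(μ_{i−k}(t) − μ_i(t))·d_k/d_i − Σ_{k≥1} λ_k(t)·d_{k+i}/d_i`
(the argument `i` stands for the state index `i ≥ 1`). -/
def alphaIVi (d : ℕ → ℝ) (lam mu : ℕ → ℝ → ℝ) (i : ℕ) (t : ℝ) : ℝ :=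
  (∑ k ∈ Finset.Icc 1 i, mu k t) + (∑' k : ℕ, lam (k + 1) t)
    - (∑ k ∈ Finset.Icc 1 (i - 1), (mu (i - k) t - mu i t) * (d k / d i))
    - ∑' k : ℕ, lam (k + 1) t * (d (k + 1 + i) / d i)

/-- `α(t) = inf_{i≥1} α_i(t)`. -/
def alphaIV (d : ℕ → ℝ) (lam mu : ℕ → ℝ → ℝ) (t : ℝ) : ℝ :=
  ⨅ i : ℕ, alphaIVi d lam mu (i + 1) t

section helpers

open scoped ENNReal

lemma exp_mul_identity (L s T : ℝ) (hsT : s ≤ T) (f S : ℝ → ℝ)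
    (hf : IntervalIntegrable f volume s T)
    (hS : ∀ t ∈ Set.Icc s T, S t = S s + ∫ u in s..t, f u) :
    Real.exp (L * (T - s)) * S T = S s +
      ∫ u in s..T, Real.exp (L * (u - s)) * (f u + L * S u) := by
  have hE : ∀ x, HasDerivAt (fun x => Real.exp (L * (x - s))) (Real.exp (L * (x - s)) * L) x := by
    intro x
    have h1 : HasDerivAt (fun x => L * (x - s)) L x := by
      simpa using ((hasDerivAt_id x).sub_const s).const_mul L
    exact h1.exp
  have hEc : Continuous fun x => Real.exp (L * (x - s)) * L := by fun_prop
  have hE2 : ∀ x, Real.exp (L * (x - s)) = 1 + ∫ u in s..x, Real.exp (L * (u - s)) * L := by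
    intro x
    rw [integral_eq_sub_of_hasDerivAt (fun y _ => hE y) (hEc.intervalIntegrable _ _)]
    simp
  have hEac : AbsolutelyContinuousOnInterval (fun x => Real.exp (L * (x - s)) - 1) s T := by
    have := (hEc.intervalIntegrable (μ := volume) s T).absolutelyContinuousOnInterval_intervalIntegral
      (c := s) (by simp)
    convert this using 2 with x
    rw [hE2 x]; ring
  have hF := hf.absolutelyContinuousOnInterval_intervalIntegral (c := s) (by simp)
  have key := hEac.integral_deriv_mul_eq_sub hF
  have hder := hf.ae_hasDerivAt_integral
  have hI : ∫ u in s..T, Real.exp (L * (u - s)) * (f u + L * S u)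
      = (∫ x in s..T, (deriv (fun x => Real.exp (L * (x - s)) - 1) x * (∫ u in s..x, f u)
        + (Real.exp (L * (x - s)) - 1) * deriv (fun x => ∫ u in s..x, f u) x)
        + (f x + (S s) * (Real.exp (L * (x - s)) * L))) := by
    apply intervalIntegral.integral_congr_ae
    filter_upwards [hder] with x hx hxm
    have hxm' : x ∈ Set.uIcc s T := Set.uIoc_subset_uIcc hxm
    rw [(hx hxm' s (by simp)).deriv, ((hE x).sub_const 1).deriv,
      hS x (by rwa [Set.uIcc_of_le hsT] at hxm')]
    ring
  have i1 : IntervalIntegrable (fun x => deriv (fun x => Real.exp (L * (x - s)) - 1) x *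
      (∫ u in s..x, f u)
        + (Real.exp (L * (x - s)) - 1) * deriv (fun x => ∫ u in s..x, f u) x) volume s T := by
    apply IntervalIntegrable.add
    · apply IntervalIntegrable.mul_continuousOn hEac.intervalIntegrable_deriv hF.continuousOn
    · apply IntervalIntegrable.continuousOn_mul hF.intervalIntegrable_deriv hEac.continuousOn
  have i2 : IntervalIntegrable (fun x => S s * (Real.exp (L * (x - s)) * L)) volume s T :=
    (hEc.intervalIntegrable _ _).const_mul _
  rw [hI, integral_add i1 (hf.add i2), integral_add hf i2, key, hS T ⟨hsT, le_rfl⟩,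
    intervalIntegral.integral_const_mul]
  have := hE2 T
  simp only [integral_same]
  have h2 : ∫ u in s..T, Real.exp (L * (u - s)) * L = Real.exp (L * (T - s)) - 1 := by linarith
  rw [h2]
  ring

lemma gron (s t : ℝ) (hst : s ≤ t) (β : ℝ → ℝ)
    (hβ : IntervalIntegrable β volume s t)
    (hβ0 : ∀ᵐ u, u ∈ Set.Ioc s t → 0 ≤ β u) :
    1 + ∫⁻ u in Set.Ioc s t, ENNReal.ofReal (β u) * ENNReal.ofReal (Real.exp (∫ v in s..u, β v))
      ≤ ENNReal.ofReal (Real.exp (∫ v in s..t, β v)) := by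
  have hF := hβ.absolutelyContinuousOnInterval_intervalIntegral (c := s) (by simp)
  have hint : ∀ x ∈ Set.Icc s t, ∀ y ∈ Set.Icc s t, IntervalIntegrable β volume x y := by
    intro x hx y hy
    exact hβ.mono_set (Set.uIcc_subset_uIcc (by rwa [Set.uIcc_of_le hst]) (by rwa [Set.uIcc_of_le hst]))
  have hmono : MonotoneOn (fun x => Real.exp (∫ v in s..x, β v)) (Set.uIcc s t) := by
    rw [Set.uIcc_of_le hst]
    intro x hx y hy hxy
    apply Real.exp_le_exp.2
    have h0 : s ∈ Set.Icc s t := ⟨le_rfl, hst⟩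
    rw [← integral_add_adjacent_intervals (hint s h0 x hx) (hint x hx y hy)]
    have : 0 ≤ ∫ u in x..y, β u := by
      apply integral_nonneg_of_ae_restrict hxy
      rw [Filter.EventuallyLE, ← restrict_Ioc_eq_restrict_Icc, ae_restrict_iff' measurableSet_Ioc]
      filter_upwards [hβ0] with u hu hm
      exact hu ⟨lt_of_le_of_lt hx.1 hm.1, hm.2.trans hy.2⟩
    linarith
  have h1 := hmono.intervalIntegral_deriv_mem_uIcc
  have h2 : ∫ x in s..t, deriv (fun x => Real.exp (∫ v in s..x, β v)) x
      = ∫ x in s..t, β x * Real.exp (∫ v in s..x, β v) := by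
    apply intervalIntegral.integral_congr_ae
    filter_upwards [hβ.ae_hasDerivAt_integral] with x hx hxm
    rw [(hx (Set.uIoc_subset_uIcc hxm) s (by simp)).exp.deriv, mul_comm]
  have hle : Real.exp (∫ v in s..s, β v) ≤ Real.exp (∫ v in s..t, β v) :=
    hmono (by simp) (by simp) hst
  rw [h2, Set.uIcc_of_le (by simpa using hle)] at h1
  have h3 := h1.2
  simp only [integral_same, Real.exp_zero] at h3
  have i1 : IntervalIntegrable (fun x => β x * Real.exp (∫ v in s..x, β v)) volume s t :=
    hβ.mul_continuousOn (Real.continuous_exp.comp_continuousOn hF.continuousOn)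
  rw [integral_of_le hst] at h3
  have h4 : ∫⁻ u in Set.Ioc s t, ENNReal.ofReal (β u) * ENNReal.ofReal (Real.exp (∫ v in s..u, β v))
      = ENNReal.ofReal (∫ u in Set.Ioc s t, β u * Real.exp (∫ v in s..u, β v)) := by
    rw [ofReal_integral_eq_lintegral_ofReal]
    · apply lintegral_congr
      intro u
      rw [ENNReal.ofReal_mul' (Real.exp_pos _).le]
    · exact (intervalIntegrable_iff_integrableOn_Ioc_of_le hst).1 i1
    · rw [Filter.EventuallyLE, ae_restrict_iff' measurableSet_Ioc]
      filter_upwards [hβ0] with u hu hm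
      exact mul_nonneg (hu hm) (Real.exp_pos _).le
  rw [h4]
  have h5 : 0 ≤ ∫ u in Set.Ioc s t, β u * Real.exp (∫ v in s..u, β v) := by
    apply setIntegral_nonneg_of_ae_restrict
    rw [Filter.EventuallyLE, ae_restrict_iff' measurableSet_Ioc]
    filter_upwards [hβ0] with u hu hm
    exact mul_nonneg (hu hm) (Real.exp_pos _).le
  rw [← ENNReal.ofReal_one, ← ENNReal.ofReal_add zero_le_one h5]
  exact ENNReal.ofReal_le_ofReal (by linarith)

/-- Picard iterates of the majorant system. -/
noncomputable def picardIter (s : ℝ) (B : ℕ → ℕ → ℝ → ℝ≥0∞) (r0 : ℕ → ℝ≥0∞) : ℕ → ℕ → ℝ → ℝ≥0∞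
  | 0 => fun _ _ => 0
  | n + 1 => fun k t => r0 k + ∫⁻ u in Set.Ioc s t, ∑' j, B k j u * picardIter s B r0 n j u

lemma picardIter_mono (s : ℝ) (B : ℕ → ℕ → ℝ → ℝ≥0∞) (r0 : ℕ → ℝ≥0∞) (n k : ℕ) :
    Monotone (picardIter s B r0 n k) := by
  cases n with
  | zero => intro x y _; simp [picardIter]
  | succ n =>
    intro x y hxy
    simp only [picardIter]
    gcongr

lemma poly_step (s t C M : ℝ) (hst : s ≤ t) (hC : 0 ≤ C) (hM : 0 ≤ M) (n : ℕ) :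
    ∫⁻ u in Set.Ioc s t, ENNReal.ofReal C * ENNReal.ofReal (M * (C * (u - s)) ^ n / n.factorial)
      = ENNReal.ofReal (M * (C * (t - s)) ^ (n + 1) / (n + 1).factorial) := by
  have h1 : ∫ u in s..t, C * (M * (C * (u - s)) ^ n / n.factorial)
      = M * (C * (t - s)) ^ (n + 1) / (n + 1).factorial := by
    have hd : ∀ x ∈ Set.uIcc s t, HasDerivAt
        (fun u => M * (C * (u - s)) ^ (n + 1) / (n + 1).factorial)
        (C * (M * (C * (x - s)) ^ n / n.factorial)) x := by
      intro x _
      have h1 : HasDerivAt (fun x => C * (x - s)) C x := by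
        simpa using ((hasDerivAt_id x).sub_const s).const_mul C
      have h2 := ((h1.pow (n + 1)).const_mul M).div_const ((n + 1).factorial : ℝ)
      have h3 : C * (M * (C * (x - s)) ^ n / n.factorial) =
          M * (↑(n + 1) * (C * (x - s)) ^ (n + 1 - 1) * C) / ↑(n + 1).factorial := ?_
      · rw [h3]; exact h2
      have : (n.factorial : ℝ) ≠ 0 := by positivity
      rw [Nat.factorial_succ]
      push_cast
      field_simp
    rw [integral_eq_sub_of_hasDerivAt hd]
    · simp
    · apply Continuous.intervalIntegrable; fun_prop
  rw [← h1, integral_of_le hst, ofReal_integral_eq_lintegral_ofReal]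
  · apply lintegral_congr
    intro u
    rw [ENNReal.ofReal_mul hC]
  · apply Continuous.integrableOn_Ioc; fun_prop
  · rw [Filter.EventuallyLE, ae_restrict_iff' measurableSet_Ioc]
    filter_upwards with u hu
    have : 0 ≤ u - s := by linarith [hu.1]
    simp only [Pi.zero_apply]; positivity

lemma comparison (s : ℝ) (B : ℕ → ℕ → ℝ → ℝ≥0∞) (r : ℕ → ℝ → ℝ≥0∞) (d : ℕ → ℝ≥0∞)
    (hdtop : ∀ k, d k ≠ ∞)
    (β e : ℝ → ℝ≥0∞) (C M : ℝ) (hC : 0 ≤ C) (hM : 0 ≤ M)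
    (hB : ∀ k j, AEMeasurable (B k j) (volume.restrict (Set.Ioi s)))
    (hem : ∀ t, s ≤ t → 1 + ∫⁻ u in Set.Ioc s t, β u * e u ≤ e t)
    (T : ℝ)
    (hr : ∀ k t, s ≤ t → t ≤ T → r k t ≤ r k s + ∫⁻ u in Set.Ioc s t, ∑' j, B k j u * r j u)
    (hrM : ∀ k t, s ≤ t → t ≤ T → r k t ≤ ENNReal.ofReal M)
    (hrow : ∀ᵐ u, s < u → ∀ k, ∑' j, B k j u ≤ ENNReal.ofReal C)
    (hcol : ∀ᵐ u, s < u → ∀ j, ∑' k, d k * B k j u ≤ β u * d j)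
    (hV : ∑' k, d k * r k s ≠ ∞)
    (t : ℝ) (hst : s ≤ t) (htT : t ≤ T) :
    ∑' k, d k * r k t ≤ (∑' k, d k * r k s) * e t := by
  set a := picardIter s B (fun k => r k s) with ha
  have ham : ∀ n k, Measurable (a n k) := fun n k => (picardIter_mono _ _ _ n k).measurable
  have hB' : ∀ t k j, AEMeasurable (B k j) (volume.restrict (Set.Ioc s t)) := fun t k j =>
    (hB k j).mono_measure (Measure.restrict_mono Set.Ioc_subset_Ioi_self le_rfl)
  have hsucc : ∀ n k t, a (n + 1) k t = r k s + ∫⁻ u in Set.Ioc s t, ∑' j, B k j u * a n j u :=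
    fun n k t => rfl
  -- pointwise bound
  have h1 : ∀ n k t, s ≤ t → t ≤ T →
      r k t ≤ a n k t + ENNReal.ofReal (M * (C * (t - s)) ^ n / n.factorial) := by
    intro n
    induction n with
    | zero => intro k t ht htT; simpa using (hrM k t ht htT).trans le_add_self
    | succ n ih =>
      intro k t ht htT
      refine (hr k t ht htT).trans ?_
      rw [hsucc, add_assoc, ← poly_step s t C M ht hC hM n]
      gcongr
      rw [← lintegral_add_left']
      · apply lintegral_mono_ae
        rw [ae_restrict_iff' measurableSet_Ioc]
        filter_upwards [hrow] with u hu hm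
        calc ∑' j, B k j u * r j u
            ≤ ∑' j, (B k j u * a n j u + B k j u *
              ENNReal.ofReal (M * (C * (u - s)) ^ n / n.factorial)) := by
              apply ENNReal.tsum_le_tsum
              intro j
              rw [← mul_add]
              gcongr
              exact ih j u hm.1.le (hm.2.trans htT)
          _ = ∑' j, B k j u * a n j u + (∑' j, B k j u) *
              ENNReal.ofReal (M * (C * (u - s)) ^ n / n.factorial) := by
              rw [ENNReal.tsum_add, ENNReal.tsum_mul_right]
          _ ≤ _ := by
              gcongr
              exact hu hm.1 k
      · exact AEMeasurable.tsum fun j => (hB' t k j).mul (ham n j).aemeasurable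
  -- weighted bound
  have h2 : ∀ n t, s ≤ t → ∑' k, d k * a n k t ≤ (∑' k, d k * r k s) * e t := by
    intro n
    induction n with
    | zero => intro t ht; simp [ha, picardIter]
    | succ n ih =>
      intro t ht
      have hmj : ∀ k j, AEMeasurable (fun u => B k j u * a n j u) (volume.restrict (Set.Ioc s t)) :=
        fun k j => (hB' t k j).mul (ham n j).aemeasurable
      calc ∑' k, d k * a (n + 1) k t
          = ∑' k, d k * r k s + ∑' k, ∫⁻ u in Set.Ioc s t, d k * ∑' j, B k j u * a n j u := by
            rw [← ENNReal.tsum_add]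
            congr 1; ext k
            rw [hsucc, mul_add, lintegral_const_mul'']
            exact AEMeasurable.tsum (hmj k)
        _ = ∑' k, d k * r k s + ∫⁻ u in Set.Ioc s t, ∑' k, d k * ∑' j, B k j u * a n j u := by
            rw [lintegral_tsum]
            intro k
            exact (AEMeasurable.tsum (hmj k)).const_mul _
        _ ≤ ∑' k, d k * r k s + ∫⁻ u in Set.Ioc s t, (∑' k, d k * r k s) * (β u * e u) := by
            refine add_le_add le_rfl ?_
            apply lintegral_mono_ae
            rw [ae_restrict_iff' measurableSet_Ioc]
            filter_upwards [hcol] with u hu hm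
            calc ∑' k, d k * ∑' j, B k j u * a n j u
                = ∑' j, (∑' k, d k * B k j u) * a n j u := by
                  simp_rw [← ENNReal.tsum_mul_left, ← ENNReal.tsum_mul_right]
                  rw [ENNReal.tsum_comm]
                  simp_rw [mul_assoc]
              _ ≤ ∑' j, (β u * d j) * a n j u := by
                  apply ENNReal.tsum_le_tsum
                  intro j
                  gcongr
                  exact hu hm.1 j
              _ = β u * ∑' j, d j * a n j u := by
                  rw [← ENNReal.tsum_mul_left]; simp_rw [mul_assoc]
              _ ≤ β u * ((∑' k, d k * r k s) * e u) := by
                  gcongr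
                  exact ih u hm.1.le
              _ = _ := by ring
        _ ≤ (∑' k, d k * r k s) * (1 + ∫⁻ u in Set.Ioc s t, β u * e u) := by
            rw [mul_add, mul_one]
            rw [lintegral_const_mul' _ _ hV]
        _ ≤ _ := by gcongr; exact hem t ht
  -- conclusion
  apply ENNReal.tsum_le_of_sum_range_le
  intro N
  have h3 : ∀ n, ∑ k ∈ Finset.range N, d k * r k t ≤ (∑' k, d k * r k s) * e t +
      (∑ k ∈ Finset.range N, d k) * ENNReal.ofReal (M * (C * (t - s)) ^ n / n.factorial) := by
    intro n
    calc _ ≤ ∑ k ∈ Finset.range N, (d k * a n k t + d k *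
          ENNReal.ofReal (M * (C * (t - s)) ^ n / n.factorial)) := by
          apply Finset.sum_le_sum
          intro k _
          rw [← mul_add]
          gcongr
          exact h1 n k t hst htT
      _ = ∑ k ∈ Finset.range N, d k * a n k t + (∑ k ∈ Finset.range N, d k) *
          ENNReal.ofReal (M * (C * (t - s)) ^ n / n.factorial) := by
          rw [Finset.sum_add_distrib, Finset.sum_mul]
      _ ≤ _ := by
          gcongr
          exact (ENNReal.sum_le_tsum _).trans (h2 n t hst)
  have h4 : Tendsto (fun n : ℕ => (∑' k, d k * r k s) * e t +
      (∑ k ∈ Finset.range N, d k) * ENNReal.ofReal (M * (C * (t - s)) ^ n / n.factorial)) atTop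
      (𝓝 ((∑' k, d k * r k s) * e t + (∑ k ∈ Finset.range N, d k) * ENNReal.ofReal (M * 0))) := by
    apply Tendsto.const_add
    apply ENNReal.Tendsto.const_mul
    · apply ENNReal.tendsto_ofReal
      simp_rw [mul_div_assoc]
      exact (FloorSemiring.tendsto_pow_div_factorial_atTop _).const_mul M
    · right
      exact ENNReal.sum_ne_top.2 fun k _ => hdtop k
  simpa using ge_of_tendsto' h4 h3

/-- Pointwise regularity of the intensities at time `u`. -/
structure GoodAt (lam mu : ℕ → ℝ → ℝ) (L u : ℝ) : Prop where
  lpos : ∀ k, 0 ≤ lam k u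
  mpos : ∀ k, 0 ≤ mu k u
  lsum : Summable (fun k : ℕ => lam (k + 1) u)
  bd : ∀ n, (∑' k : ℕ, lam (k + 1) u) + ∑ k ∈ Finset.Icc 1 n, mu k u ≤ L
  mdec : ∀ k, 1 ≤ k → mu (k + 1) u ≤ mu k u

/-- Matrix of the system for the tails. -/
def tailMatrix (lam mu : ℕ → ℝ → ℝ) (k j : ℕ) (u : ℝ) : ℝ :=
  if j < k then lam (k - j) u
  else if j = k then -((∑' i : ℕ, lam (i + 1) u) + ∑ i ∈ Finset.Icc 1 (k + 1), mu i u)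
  else mu (j - k) u - mu (j + 1) u

/-- Shifted (nonnegative) matrix. -/
def tailMatrixPos (L : ℝ) (lam mu : ℕ → ℝ → ℝ) (k j : ℕ) (u : ℝ) : ℝ :=
  tailMatrix lam mu k j u + if j = k then L else 0

lemma tail_eq (lam mu : ℕ → ℝ → ℝ) (k j : ℕ) (u : ℝ) :
    -(∑ i ∈ Finset.range (k + 1),
      (classIVMatrix lam mu i (j + 1) u - classIVMatrix lam mu i j u)) = tailMatrix lam mu k j u := by
  induction k with
  | zero =>
    rcases Nat.eq_zero_or_pos j with rfl | hj
    · simp [classIVMatrix, tailMatrix]; ring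
    · have h1 : j ≠ 0 := by omega
      have h2 : ¬ (0 = j) := by omega
      simp [classIVMatrix, tailMatrix, hj, h1]
  | succ k ih =>
    rw [Finset.sum_range_succ, neg_add, ih]
    rcases lt_trichotomy j k with h | rfl | h
    · have e1 : j < k + 1 := by omega
      have e2 : k + 1 - (j + 1) = k - j := by omega
      have e3 : ¬ (k < j) := by omega
      simp [classIVMatrix, tailMatrix, h, e1, e2, e3]
    · have e1 : j + 1 - j = 1 := by omega
      simp [classIVMatrix, tailMatrix, e1]
    · rcases Nat.eq_or_lt_of_le (Nat.succ_le_of_lt h) with rfl | h'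
      · have e1 : k + 1 - k = 1 := by omega
        have e2 : k + 1 + 1 - (k + 1) = 1 := by omega
        simp [classIVMatrix, tailMatrix, e1, e2, Finset.sum_Icc_succ_top]; ring
      · simp only [Nat.succ_eq_add_one] at h'
        have c1 : ¬ (j + 1 < k + 1) := by omega
        have c2 : ¬ (j < k) := by omega
        have c3 : ¬ (j = k) := by omega
        have c4 : ¬ (j < k + 1) := by omega
        have c5 : ¬ (j = k + 1) := by omega
        have c6 : k < j := by omega
        have c7 : j + 1 - (k + 1) = j - k := by omega
        have c8 : ¬ (j + 1 ≤ k + 1) := by omega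
        have c9 : ¬ (j + 1 + 1 ≤ k + 1) := by omega
        have c10 : k + 1 < j + 1 := by omega
        simp only [classIVMatrix, tailMatrix, c2, c3, c4, c5, c7, c8, c9, c10, h', if_true, if_false]
        ring

lemma GoodAt.Lpos {lam mu : ℕ → ℝ → ℝ} {L u : ℝ} (h : GoodAt lam mu L u) : 0 ≤ L := by
  have := h.bd 0
  have h2 : 0 ≤ ∑' k : ℕ, lam (k + 1) u := tsum_nonneg fun k => h.lpos _
  simp at this; linarith

lemma GoodAt.Lam_nonneg {lam mu : ℕ → ℝ → ℝ} {L u : ℝ} (h : GoodAt lam mu L u) :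
    0 ≤ ∑' k : ℕ, lam (k + 1) u := tsum_nonneg fun k => h.lpos _

lemma GoodAt.Mu_nonneg {lam mu : ℕ → ℝ → ℝ} {L u : ℝ} (h : GoodAt lam mu L u) (n : ℕ) :
    0 ≤ ∑ k ∈ Finset.Icc 1 n, mu k u := Finset.sum_nonneg fun k _ => h.mpos _

lemma GoodAt.lam_le {lam mu : ℕ → ℝ → ℝ} {L u : ℝ} (h : GoodAt lam mu L u) (k : ℕ) (hk : 1 ≤ k) :
    lam k u ≤ L := by
  obtain ⟨k, rfl⟩ := Nat.exists_eq_add_of_le' hk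
  have h1 : lam (k + 1) u ≤ ∑' k : ℕ, lam (k + 1) u :=
    h.lsum.le_tsum k (fun j _ => h.lpos _)
  have := h.bd 0
  simp at this; linarith

lemma GoodAt.mu_le {lam mu : ℕ → ℝ → ℝ} {L u : ℝ} (h : GoodAt lam mu L u) (k : ℕ) (hk : 1 ≤ k) :
    mu k u ≤ L := by
  have h1 : mu k u ≤ ∑ i ∈ Finset.Icc 1 k, mu i u :=
    Finset.single_le_sum (f := fun i => mu i u) (fun i _ => h.mpos i) (by simp [hk])
  have := h.bd k
  have := h.Lam_nonneg
  linarith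

lemma GoodAt.abs_le {lam mu : ℕ → ℝ → ℝ} {L u : ℝ} (h : GoodAt lam mu L u) (i j : ℕ) :
    |classIVMatrix lam mu i j u| ≤ L := by
  unfold classIVMatrix
  split_ifs with h1 h2 h3
  · rw [abs_of_nonneg (h.lpos _)]; exact h.lam_le _ (by omega)
  · rw [abs_of_nonneg (h.mpos _)]; exact h.mu_le _ (by omega)
  · rw [abs_neg, abs_of_nonneg (add_nonneg h.Lam_nonneg (h.Mu_nonneg _))]; exact h.bd _
  · simpa using h.Lpos

lemma GoodAt.mu_anti {lam mu : ℕ → ℝ → ℝ} {L u : ℝ} (h : GoodAt lam mu L u) (i j : ℕ)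
    (hi : 1 ≤ i) (hij : i ≤ j) : mu j u ≤ mu i u := by
  induction j, hij using Nat.le_induction with
  | base => exact le_rfl
  | succ n hn ih => exact (h.mdec n (by omega)).trans ih

lemma GoodAt.pos_nonneg {lam mu : ℕ → ℝ → ℝ} {L u : ℝ} (h : GoodAt lam mu L u) (k j : ℕ) :
    0 ≤ tailMatrixPos L lam mu k j u := by
  unfold tailMatrixPos tailMatrix
  split_ifs with h1 h2 h3
  · omega
  · simpa using h.lpos _
  · linarith [h.bd (k + 1)]
  · have := h.mu_anti (j - k) (j + 1) (by omega) (by omega)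
    linarith

lemma GoodAt.row_partial {lam mu : ℕ → ℝ → ℝ} {L u : ℝ} (h : GoodAt lam mu L u) (k n : ℕ) :
    ∑ j ∈ Finset.range n, tailMatrixPos L lam mu k j u ≤ 3 * L := by
  calc ∑ j ∈ Finset.range n, tailMatrixPos L lam mu k j u
      ≤ ∑ j ∈ Finset.range (k + 1 + n), tailMatrixPos L lam mu k j u :=
        Finset.sum_le_sum_of_subset_of_nonneg (Finset.range_mono (by omega))
          fun j _ _ => h.pos_nonneg k j
    _ = ∑ j ∈ Finset.range k, lam (k - j) u
        + (L - ((∑' i : ℕ, lam (i + 1) u) + ∑ i ∈ Finset.Icc 1 (k + 1), mu i u))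
        + ∑ i ∈ Finset.range n, (mu (i + 1) u - mu (i + k + 2) u) := by
        rw [Finset.sum_range_add, Finset.sum_range_succ]
        congr 1
        · congr 1
          · apply Finset.sum_congr rfl
            intro j hj
            have hj := Finset.mem_range.1 hj
            simp [tailMatrixPos, tailMatrix, hj, hj.ne]
          · simp [tailMatrixPos, tailMatrix]; ring
        · apply Finset.sum_congr rfl
          intro i _
          have c1 : ¬ (k + 1 + i < k) := by omega
          have c2 : ¬ (k + 1 + i = k) := by omega
          have c3 : k + 1 + i - k = i + 1 := by omega
          have c4 : k + 1 + i + 1 = i + k + 2 := by omega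
          simp [tailMatrixPos, tailMatrix, c1, c2, c3, c4]
    _ ≤ (∑' i : ℕ, lam (i + 1) u) + L + L := by
        have e1 : ∑ j ∈ Finset.range k, lam (k - j) u ≤ ∑' i : ℕ, lam (i + 1) u := by
          have : ∑ j ∈ Finset.range k, lam (k - j) u = ∑ j ∈ Finset.range k, lam (j + 1) u := by
            rw [← Finset.sum_range_reflect]
            apply Finset.sum_congr rfl
            intro j hj
            have hj := Finset.mem_range.1 hj
            congr 1; omega
          rw [this]
          exact h.lsum.sum_le_tsum _ fun i _ => h.lpos _
        have e2 : ∑ i ∈ Finset.range n, (mu (i + 1) u - mu (i + k + 2) u) ≤ L := by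
          calc _ ≤ ∑ i ∈ Finset.range n, mu (i + 1) u := by
                apply Finset.sum_le_sum
                intro i _
                linarith [h.mpos (i + k + 2)]
            _ = ∑ i ∈ Finset.Icc 1 n, mu i u := by
                rw [Finset.range_eq_Ico, Finset.sum_Ico_add' (fun i => mu i u) 0 n 1]
                rfl
            _ ≤ L := by linarith [h.bd n, h.Lam_nonneg]
        linarith [h.Lam_nonneg, h.Mu_nonneg (k + 1)]
    _ ≤ 3 * L := by
        have := h.bd 0
        simp at this; linarith

lemma GoodAt.row {lam mu : ℕ → ℝ → ℝ} {L u : ℝ} (h : GoodAt lam mu L u) (k : ℕ) :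
    ∑' j, ENNReal.ofReal (tailMatrixPos L lam mu k j u) ≤ ENNReal.ofReal (3 * L) := by
  apply ENNReal.tsum_le_of_sum_range_le
  intro n
  rw [← ENNReal.ofReal_sum_of_nonneg fun j _ => h.pos_nonneg k j]
  exact ENNReal.ofReal_le_ofReal (h.row_partial k n)

lemma GoodAt.row_summable {lam mu : ℕ → ℝ → ℝ} {L u : ℝ} (h : GoodAt lam mu L u) (k : ℕ) :
    Summable (fun j => tailMatrixPos L lam mu k j u) :=
  summable_of_sum_range_le (fun j => h.pos_nonneg k j) (h.row_partial k)

lemma GoodAt.col {lam mu : ℕ → ℝ → ℝ} {L u : ℝ} (h : GoodAt lam mu L u) (d : ℕ → ℝ)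
    (hdpos : ∀ k, 1 ≤ k → 0 < d k) (j : ℕ)
    (hs : Summable (fun k : ℕ => lam (k + 1) u * (d (k + 1 + (j + 1)) / d (j + 1)))) :
    HasSum (fun k => d (k + 1) * tailMatrixPos L lam mu k j u)
      ((L - alphaIVi d lam mu (j + 1) u) * d (j + 1)) := by
  have hd := hdpos (j + 1) (by omega)
  rw [← hasSum_nat_add_iff' (j + 1)]
  have e0 : ∀ k, d (k + (j + 1) + 1) * tailMatrixPos L lam mu (k + (j + 1)) j u
      = lam (k + 1) u * (d (k + 1 + (j + 1)) / d (j + 1)) * d (j + 1) := by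
    intro k
    have c1 : j < k + (j + 1) := by omega
    have c2 : j ≠ k + (j + 1) := by omega
    have c3 : k + (j + 1) - j = k + 1 := by omega
    have c4 : k + (j + 1) + 1 = k + 1 + (j + 1) := by omega
    simp only [tailMatrixPos, tailMatrix, c1, c2, c3, c4, if_true, if_false]
    field_simp
    ring
  simp_rw [e0]
  have := hs.hasSum.mul_right (d (j + 1))
  suffices hh : (L - alphaIVi d lam mu (j + 1) u) * d (j + 1) -
      ∑ i ∈ Finset.range (j + 1), d (i + 1) * tailMatrixPos L lam mu i j u =
      (∑' b : ℕ, lam (b + 1) u * (d (b + 1 + (j + 1)) / d (j + 1))) * d (j + 1) by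
    rw [hh]; exact this
  rw [Finset.sum_range_succ]
  have e1 : ∑ k ∈ Finset.range j, d (k + 1) * tailMatrixPos L lam mu k j u
      = (∑ k ∈ Finset.Icc 1 j, (mu (j + 1 - k) u - mu (j + 1) u) * (d k / d (j + 1))) * d (j + 1) := by
    have : Finset.Icc 1 j = Finset.Ico (0 + 1) (j + 1) := rfl
    rw [this, ← Finset.sum_Ico_add' (fun k => (mu (j + 1 - k) u - mu (j + 1) u) * (d k / d (j + 1))),
      ← Finset.range_eq_Ico, Finset.sum_mul]
    apply Finset.sum_congr rfl
    intro k hk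
    have hk := Finset.mem_range.1 hk
    have c1 : ¬ (j < k) := by omega
    have c2 : ¬ (j = k) := by omega
    have c3 : j + 1 - (k + 1) = j - k := by omega
    simp only [tailMatrixPos, tailMatrix, c1, c2, c3, if_false]
    field_simp
    ring
  rw [e1]
  simp only [alphaIVi, tailMatrixPos, tailMatrix, lt_irrefl, if_true, if_false, Nat.add_sub_cancel]
  ring

lemma GoodAt.alpha_le {lam mu : ℕ → ℝ → ℝ} {L u : ℝ} (h : GoodAt lam mu L u) (d : ℕ → ℝ)
    (hdpos : ∀ k, 1 ≤ k → 0 < d k) 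
    (hb : BddBelow (Set.range fun i : ℕ => alphaIVi d lam mu (i + 1) u)) :
    alphaIV d lam mu u ≤ L := by
  refine (ciInf_le hb 0).trans ?_
  have h1 : 0 ≤ ∑' k : ℕ, lam (k + 1) u * (d (k + 1 + 1) / d 1) := 
    tsum_nonneg fun k => mul_nonneg (h.lpos _) (div_nonneg (hdpos _ (by omega)).le (hdpos _ le_rfl).le)
  have h2 := h.bd 1
  simp only [alphaIVi, zero_add]
  simp at h2 ⊢
  linarith

lemma GoodAt.col' {lam mu : ℕ → ℝ → ℝ} {L u : ℝ} (h : GoodAt lam mu L u) (d : ℕ → ℝ)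
    (hdpos : ∀ k, 1 ≤ k → 0 < d k) (j : ℕ)
    (hs : Summable (fun k : ℕ => lam (k + 1) u * (d (k + 1 + (j + 1)) / d (j + 1))))
    (hb : BddBelow (Set.range fun i : ℕ => alphaIVi d lam mu (i + 1) u)) :
    ∑' k, ENNReal.ofReal (d (k + 1)) * ENNReal.ofReal (tailMatrixPos L lam mu k j u)
      ≤ ENNReal.ofReal (L - alphaIV d lam mu u) * ENNReal.ofReal (d (j + 1)) := by
  have hc := h.col d hdpos j hs
  have hd : ∀ k, 0 ≤ d (k + 1) := fun k => (hdpos _ (by omega)).le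
  simp_rw [← fun k => ENNReal.ofReal_mul (q := tailMatrixPos L lam mu k j u) (hd k)]
  rw [← ENNReal.ofReal_tsum_of_nonneg (fun k => mul_nonneg (hd k) (h.pos_nonneg k j)) hc.summable,
    hc.tsum_eq, ← ENNReal.ofReal_mul' (hd j)]
  apply ENNReal.ofReal_le_ofReal
  have := ciInf_le hb j
  exact mul_le_mul_of_nonneg_right (by unfold alphaIV; linarith) (hd j)

lemma abel_partial (g S : ℕ → ℝ) (h0 : S 0 = 0) (n : ℕ) :
    ∑ j ∈ Finset.range (n + 1), g j * (S j - S (j + 1))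
      = ∑ j ∈ Finset.range n, (g (j + 1) - g j) * S (j + 1) - g n * S (n + 1) := by
  induction n with
  | zero => simp [h0]
  | succ n ih => rw [Finset.sum_range_succ, ih, Finset.sum_range_succ]; ring

lemma GoodAt.abel {lam mu : ℕ → ℝ → ℝ} {L u : ℝ} (h : GoodAt lam mu L u) (w S : ℕ → ℝ)
    (h0 : S 0 = 0) (hw : ∀ j, w j = S j - S (j + 1)) (hws : Summable w)
    (hS : Tendsto S atTop (𝓝 0)) (M : ℝ) (hM : ∀ j, |S j| ≤ M) (k : ℕ) :
    -(∑ i ∈ Finset.range (k + 1), ∑' j, classIVMatrix lam mu i j u * w j)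
      = ∑' j, tailMatrix lam mu k j u * S (j + 1) ∧
    Summable (fun j => tailMatrixPos L lam mu k j u * S (j + 1)) ∧
    Summable (fun j => tailMatrix lam mu k j u * S (j + 1)) := by
  have hsum : ∀ i, Summable (fun j => classIVMatrix lam mu i j u * w j) := by
    intro i
    apply Summable.of_norm_bounded (hws.abs.mul_left L)
    intro j
    rw [Real.norm_eq_abs, abs_mul]
    exact mul_le_mul_of_nonneg_right (h.abs_le i j) (abs_nonneg _)
  have hpos : Summable (fun j => tailMatrixPos L lam mu k j u * S (j + 1)) := by
    apply Summable.of_norm_bounded ((h.row_summable k).mul_right M)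
    intro j
    rw [Real.norm_eq_abs, abs_mul, abs_of_nonneg (h.pos_nonneg k j)]
    exact mul_le_mul_of_nonneg_left (hM _) (h.pos_nonneg k j)
  have htail : Summable (fun j => tailMatrix lam mu k j u * S (j + 1)) := by
    have h2 : Summable (fun j => (if j = k then L else 0) * S (j + 1)) :=
      summable_of_ne_finset_zero (s := {k}) (by intro b hb; simp at hb; simp [hb])
    have := hpos.sub h2
    refine this.congr fun j => ?_
    simp only [tailMatrixPos]; ring
  refine ⟨?_, hpos, htail⟩
  set g : ℕ → ℝ := fun j => -∑ i ∈ Finset.range (k + 1), classIVMatrix lam mu i j u with hg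
  have e1 : -(∑ i ∈ Finset.range (k + 1), ∑' j, classIVMatrix lam mu i j u * w j)
      = ∑' j, g j * (S j - S (j + 1)) := by
    rw [← Summable.tsum_finsetSum (fun i _ => hsum i), ← tsum_neg]
    congr 1; ext j
    rw [← hw, hg, neg_mul, Finset.sum_mul]
  have gs : Summable (fun j => g j * (S j - S (j + 1))) := by
    have := (summable_sum (fun i (_ : i ∈ Finset.range (k + 1)) => hsum i)).neg
    refine this.congr fun j => ?_
    rw [← hw, hg, neg_mul, Finset.sum_mul]
  have gb : ∀ j, |g j| ≤ (k + 1) * L := by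
    intro j
    rw [hg, abs_neg]
    refine (Finset.abs_sum_le_sum_abs _ _).trans ?_
    refine (Finset.sum_le_sum fun i _ => h.abs_le i j).trans ?_
    simp
  rw [e1]
  have t1 := (gs.hasSum.tendsto_sum_nat).comp (tendsto_add_atTop_nat 1)
  have t2 := htail.hasSum.tendsto_sum_nat
  have t3 : Tendsto (fun n => g n * S (n + 1)) atTop (𝓝 0) := by
    apply squeeze_zero_norm (a := fun n => ((k + 1) * L) * |S (n + 1)|)
    · intro n
      rw [Real.norm_eq_abs, abs_mul]
      exact mul_le_mul_of_nonneg_right (gb n) (abs_nonneg _)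
    · have := ((hS.comp (tendsto_add_atTop_nat 1)).abs).const_mul ((k + 1) * L)
      simpa using this
  have t4 := t2.sub t3
  rw [sub_zero] at t4
  refine tendsto_nhds_unique t1 (t4.congr fun n => ?_)
  simp only [Function.comp]
  rw [abel_partial g S h0 n]
  congr 1
  apply Finset.sum_congr rfl
  intro j _
  rw [← tail_eq lam mu k j u, Finset.sum_sub_distrib]
  simp only [hg]
  ring


lemma matrix_meas (lam mu : ℕ → ℝ → ℝ)
    (hlamloc : ∀ k, LocallyIntegrableOn (lam k) (Set.Ici 0))
    (hmuloc : ∀ k, LocallyIntegrableOn (mu k) (Set.Ici 0)) :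
    (∀ k, AEMeasurable (lam k) (volume.restrict (Set.Ici 0))) ∧
    (∀ k, AEMeasurable (mu k) (volume.restrict (Set.Ici 0))) ∧
    (∀ i j, AEMeasurable (classIVMatrix lam mu i j) (volume.restrict (Set.Ici 0))) ∧
    (∀ L k j, AEMeasurable (tailMatrixPos L lam mu k j) (volume.restrict (Set.Ici 0))) := by
  have h1 : ∀ k, AEMeasurable (lam k) (volume.restrict (Set.Ici 0)) := fun k =>
    (hlamloc k).aestronglyMeasurable.aemeasurable
  have h2 : ∀ k, AEMeasurable (mu k) (volume.restrict (Set.Ici 0)) := fun k =>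
    (hmuloc k).aestronglyMeasurable.aemeasurable
  have h3 : AEMeasurable (fun t => ∑' k : ℕ, lam (k + 1) t) (volume.restrict (Set.Ici 0)) :=
    AEMeasurable.tsum fun k => h1 (k + 1)
  have h4 : ∀ n, AEMeasurable (fun t => ∑ k ∈ Finset.Icc 1 n, mu k t)
      (volume.restrict (Set.Ici 0)) := fun n =>
    Finset.aemeasurable_fun_sum _ fun k _ => h2 k
  refine ⟨h1, h2, ?_, ?_⟩
  · intro i j
    unfold classIVMatrix
    split_ifs
    · exact h1 _
    · exact h2 _
    · exact (h3.add (h4 _)).neg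
    · exact aemeasurable_const
  · intro L k j
    unfold tailMatrixPos tailMatrix
    apply AEMeasurable.add _ aemeasurable_const
    split_ifs
    · exact h1 _
    · exact (h3.add (h4 _)).neg
    · exact (h2 _).sub (h2 _)

lemma sol_meas (a : ℕ → ℕ → ℝ → ℝ) (p : ℝ → ℕ → ℝ) (hp : IsKolmogorovSolution a p) (i : ℕ) :
    AEMeasurable (fun t => p t i) (volume.restrict (Set.Ici 0)) := by
  classical
  set f : ℝ → ℝ := fun u => ∑' j : ℕ, a i j u * p u j with hf
  set I : Set ℝ := {t | 0 ≤ t ∧ IntervalIntegrable f volume 0 t} with hI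
  have hsub : ∀ x ∈ I, ∀ y, 0 ≤ y → y ≤ x → y ∈ I := by
    intro x hx y h0 hy
    refine ⟨h0, hx.2.mono_set ?_⟩
    rw [Set.uIcc_of_le h0, Set.uIcc_of_le hx.1]
    exact Set.Icc_subset_Icc_right hy
  have hmI : MeasurableSet I := by
    apply Set.OrdConnected.measurableSet
    refine ⟨fun x hx y hy z hz => hsub y hy z (hx.1.trans hz.1) hz.2⟩
  have hc : ContinuousOn (fun t => ∫ u in (0:ℝ)..t, f u) I := by
    have hc1 : ∀ y ∈ I, ContinuousOn (fun t => ∫ u in (0:ℝ)..t, f u) (Set.Icc 0 y) := by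
      intro y hy
      have := (hy.2.absolutelyContinuousOnInterval_intervalIntegral (c := 0) (by simp)).continuousOn
      rwa [Set.uIcc_of_le hy.1] at this
    intro x hx
    by_cases h : ∃ y ∈ I, x < y
    · obtain ⟨y, hy, hxy⟩ := h
      have h1 := hc1 y hy x ⟨hx.1, hxy.le⟩
      refine h1.mono_of_mem_nhdsWithin ?_
      have : Set.Iio y ∩ I ∈ 𝓝[I] x := Filter.inter_mem (mem_nhdsWithin_of_mem_nhds (Iio_mem_nhds hxy)) self_mem_nhdsWithin
      exact Filter.mem_of_superset this fun z hz => ⟨hz.2.1, le_of_lt hz.1⟩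
    · push Not at h
      exact (hc1 x hx x ⟨hx.1, le_rfl⟩).mono fun z hz => ⟨hz.1, h z hz⟩
  have hm : Measurable (I.piecewise (fun t => ∫ u in (0:ℝ)..t, f u) (fun _ => 0)) :=
    hc.measurable_piecewise continuousOn_const hmI
  refine AEMeasurable.congr (hm.const_add (p 0 i)).aemeasurable ?_
  rw [Filter.EventuallyEq, ae_restrict_iff' measurableSet_Ici]
  filter_upwards with t ht
  rw [hp.2 i 0 t le_rfl ht]
  congr 1
  by_cases h : t ∈ I
  · simp [h, hf]
  · rw [Set.piecewise_eq_of_notMem _ _ _ h]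
    symm
    apply intervalIntegral.integral_undef
    intro h2
    exact h ⟨ht, h2⟩

lemma sol_int (lam mu : ℕ → ℝ → ℝ) (L : ℝ)
    (hlamloc : ∀ k, LocallyIntegrableOn (lam k) (Set.Ici 0))
    (hmuloc : ∀ k, LocallyIntegrableOn (mu k) (Set.Ici 0))
    (hgood : ∀ᵐ u : ℝ, 0 ≤ u → GoodAt lam mu L u)
    (p : ℝ → ℕ → ℝ) (hp : IsKolmogorovSolution (classIVMatrix lam mu) p) (i : ℕ)
    (s t : ℝ) (hs : 0 ≤ s) (hst : s ≤ t) :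
    IntervalIntegrable (fun u => ∑' j : ℕ, classIVMatrix lam mu i j u * p u j) volume s t := by
  rw [intervalIntegrable_iff_integrableOn_Ioc_of_le hst]
  have hm := (matrix_meas lam mu hlamloc hmuloc).2.2.1
  have hsub : Set.Ioc s t ⊆ Set.Ici 0 := fun x hx => hs.trans hx.1.le
  have hmeas : AEMeasurable (fun u => ∑' j : ℕ, classIVMatrix lam mu i j u * p u j)
      (volume.restrict (Set.Ioc s t)) := by
    refine AEMeasurable.mono_measure ?_ (Measure.restrict_mono hsub le_rfl)
    exact AEMeasurable.tsum fun j => (hm i j).mul (sol_meas _ p hp j)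
  refine IntegrableOn.of_bound (by simp) hmeas.aestronglyMeasurable L ?_
  rw [ae_restrict_iff' measurableSet_Ioc]
  filter_upwards [hgood] with u hu hm
  have hu0 : 0 ≤ u := hsub hm
  have hg := hu hu0
  obtain ⟨hp0, hp1⟩ := hp.1 u hu0
  have := tsum_of_norm_bounded (f := fun j => classIVMatrix lam mu i j u * p u j)
    (hp1.mul_left L) (fun j => by
      rw [Real.norm_eq_abs, abs_mul, abs_of_nonneg (hp0 j)]
      exact mul_le_mul_of_nonneg_right (hg.abs_le i j) (hp0 j))
  simpa using this

/-- Tails of the difference of two distributions, written as finite sums. -/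
def tailS (w : ℕ → ℝ) (k : ℕ) : ℝ := -∑ i ∈ Finset.range k, w i

lemma tailS_facts (q₁ q₂ : ℕ → ℝ) (h1 : ∀ i, 0 ≤ q₁ i) (h2 : ∀ i, 0 ≤ q₂ i)
    (s1 : HasSum q₁ 1) (s2 : HasSum q₂ 1) :
    Summable (fun k => q₁ k - q₂ k) ∧
    Tendsto (tailS (fun k => q₁ k - q₂ k)) atTop (𝓝 0) ∧
    (∀ k, |tailS (fun k => q₁ k - q₂ k) k| ≤ 2) ∧
    (∀ k, tailS (fun k => q₁ k - q₂ k) k = ∑' i, (q₁ (k + i) - q₂ (k + i))) := by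
  have hs := s1.sub s2
  rw [sub_self] at hs
  refine ⟨hs.summable, ?_, ?_, ?_⟩
  · have := hs.tendsto_sum_nat.neg
    rw [neg_zero] at this
    exact this
  · intro k
    rw [tailS, abs_neg, Finset.sum_sub_distrib]
    have a1 := sum_le_hasSum (Finset.range k) (fun i _ => h1 i) s1
    have a2 := sum_le_hasSum (Finset.range k) (fun i _ => h2 i) s2
    have b1 := Finset.sum_nonneg (s := Finset.range k) (fun i _ => h1 i)
    have b2 := Finset.sum_nonneg (s := Finset.range k) (fun i _ => h2 i)
    rw [abs_le]
    constructor <;> linarith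
  · intro k
    have := hs.summable.sum_add_tsum_nat_add k
    rw [hs.tsum_eq] at this
    rw [tailS]
    simp_rw [add_comm k]
    linarith

lemma l1_le (S : ℕ → ℝ) (h0 : S 0 = 0) (X : ℝ) (hX : 0 ≤ X)
    (h : ∑' k, ENNReal.ofReal |S (k + 1)| ≤ ENNReal.ofReal X) :
    ∑' k, |S k - S (k + 1)| ≤ 4 * X := by
  have h1 : ∑' k, ENNReal.ofReal |S k| = ∑' k, ENNReal.ofReal |S (k + 1)| := by
    rw [tsum_eq_zero_add' ENNReal.summable]
    simp [h0]
  have h2 : ∑' k, ENNReal.ofReal |S k - S (k + 1)| ≤ ENNReal.ofReal (2 * X) := by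
    calc _ ≤ ∑' k, (ENNReal.ofReal |S k| + ENNReal.ofReal |S (k + 1)|) := by
          apply ENNReal.tsum_le_tsum
          intro k
          rw [← ENNReal.ofReal_add (abs_nonneg _) (abs_nonneg _)]
          exact ENNReal.ofReal_le_ofReal (abs_sub _ _)
      _ ≤ ENNReal.ofReal X + ENNReal.ofReal X := by
          rw [ENNReal.tsum_add, h1]
          gcongr
      _ = _ := by rw [← ENNReal.ofReal_add hX hX]; congr 1; ring
  have h3 : ∑' k, |S k - S (k + 1)| ≤ 2 * X := by
    apply Real.tsum_le_of_sum_range_le (fun k => abs_nonneg _)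
    intro n
    rw [← ENNReal.ofReal_le_ofReal_iff (by positivity),
      ENNReal.ofReal_sum_of_nonneg fun k _ => abs_nonneg _]
    exact (ENNReal.sum_le_tsum _).trans h2
  linarith

lemma tail_integral_eq
    (lam mu : ℕ → ℝ → ℝ) (L : ℝ)
    (hlamloc : ∀ k, LocallyIntegrableOn (lam k) (Set.Ici 0))
    (hmuloc : ∀ k, LocallyIntegrableOn (mu k) (Set.Ici 0))
    (hgood : ∀ᵐ u : ℝ, 0 ≤ u → GoodAt lam mu L u)
    (p₁ p₂ : ℝ → ℕ → ℝ)
    (hp₁ : IsKolmogorovSolution (classIVMatrix lam mu) p₁)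
    (hp₂ : IsKolmogorovSolution (classIVMatrix lam mu) p₂)
    (s t : ℝ) (hs : 0 ≤ s) (hst : s ≤ t) (k : ℕ) :
    ENNReal.ofReal |Real.exp (L * (t - s)) * tailS (fun k => p₁ t k - p₂ t k) (k + 1)| ≤
      ENNReal.ofReal |tailS (fun k => p₁ s k - p₂ s k) (k + 1)| +
      ∫⁻ u in Set.Ioc s t, ∑' j, ENNReal.ofReal (tailMatrixPos L lam mu k j u) *
        ENNReal.ofReal |Real.exp (L * (u - s)) * tailS (fun k => p₁ u k - p₂ u k) (j + 1)| := by
  set f : ℝ → ℝ := fun u => -∑ i ∈ Finset.range (k + 1),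
    ((∑' j : ℕ, classIVMatrix lam mu i j u * p₁ u j) -
      (∑' j : ℕ, classIVMatrix lam mu i j u * p₂ u j)) with hf
  have hi1 : ∀ x, s ≤ x → ∀ i, _ := fun x hx i => sol_int lam mu L hlamloc hmuloc hgood p₁ hp₁ i s x hs hx
  have hi2 : ∀ x, s ≤ x → ∀ i, _ := fun x hx i => sol_int lam mu L hlamloc hmuloc hgood p₂ hp₂ i s x hs hx
  have hfi : IntervalIntegrable f volume s t := by
    apply IntervalIntegrable.neg
    have := IntervalIntegrable.sum (Finset.range (k + 1))
      (fun i _ => (hi1 t hst i).sub (hi2 t hst i))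
    rw [Finset.sum_fn] at this
    exact this
  have hS : ∀ x ∈ Set.Icc s t, tailS (fun k => p₁ x k - p₂ x k) (k + 1) =
      tailS (fun k => p₁ s k - p₂ s k) (k + 1) + ∫ u in s..x, f u := by
    intro x hx
    rw [hf, intervalIntegral.integral_neg, intervalIntegral.integral_finsetSum
      (fun i _ => (hi1 x hx.1 i).sub (hi2 x hx.1 i))]
    simp only [tailS]
    rw [← neg_add, ← Finset.sum_add_distrib]
    congr 1
    apply Finset.sum_congr rfl
    intro i _
    rw [intervalIntegral.integral_sub (hi1 x hx.1 i) (hi2 x hx.1 i), hp₁.2 i s x hs hx.1,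
      hp₂.2 i s x hs hx.1]
    ring
  have key := exp_mul_identity L s t hst f (fun x => tailS (fun k => p₁ x k - p₂ x k) (k + 1)) hfi hS
  rw [key]
  refine (ENNReal.ofReal_le_ofReal (abs_add_le _ _)).trans ?_
  rw [ENNReal.ofReal_add (abs_nonneg _) (abs_nonneg _)]
  refine add_le_add le_rfl ?_
  rw [intervalIntegral.integral_of_le hst, ← Real.enorm_eq_ofReal_abs]
  refine (enorm_integral_le_lintegral_enorm _).trans ?_
  apply lintegral_mono_ae
  rw [ae_restrict_iff' measurableSet_Ioc]
  filter_upwards [hgood] with u hu hm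
  have hu0 : 0 ≤ u := hs.trans hm.1.le
  have hg := hu hu0
  obtain ⟨a1, b1⟩ := hp₁.1 u hu0
  obtain ⟨a2, b2⟩ := hp₂.1 u hu0
  obtain ⟨c1, c2, c3, c4⟩ := tailS_facts (p₁ u) (p₂ u) a1 a2 b1 b2
  set S := tailS (fun k => p₁ u k - p₂ u k) with hSdef
  obtain ⟨e1, e2, e3⟩ := hg.abel (fun k => p₁ u k - p₂ u k) S (by simp [hSdef, tailS])
    (fun j => by simp only [hSdef, tailS, Finset.sum_range_succ]; ring) c1 c2 2 c3 k
  have hfu : f u = ∑' j, tailMatrix lam mu k j u * S (j + 1) := by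
    rw [← e1, hf]
    simp only
    congr 1
    apply Finset.sum_congr rfl
    intro i _
    have hsum : ∀ p : ℕ → ℝ, Summable p → Summable (fun j => classIVMatrix lam mu i j u * p j) := by
      intro p hp
      apply Summable.of_norm_bounded (hp.abs.mul_left L)
      intro j
      rw [Real.norm_eq_abs, abs_mul]
      exact mul_le_mul_of_nonneg_right (hg.abs_le i j) (abs_nonneg _)
    rw [← (hsum _ b1.summable).tsum_sub (hsum _ b2.summable)]
    congr 1; ext j; ring
  have hfu2 : f u + L * S (k + 1) = ∑' j, tailMatrixPos L lam mu k j u * S (j + 1) := by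
    rw [hfu]
    have h2 : HasSum (fun j => (if j = k then L else 0) * S (j + 1)) (L * S (k + 1)) := by
      have := hasSum_single (f := fun j => (if j = k then L else 0) * S (j + 1)) k
        (fun b hb => by simp [hb])
      simpa using this
    rw [← (e3.hasSum.add h2).tsum_eq]
    congr 1; ext j
    simp only [tailMatrixPos]; ring
  rw [hfu2, ← tsum_mul_left]
  refine enorm_tsum_le_tsum_enorm.trans ?_
  apply ENNReal.tsum_le_tsum
  intro j
  rw [Real.enorm_eq_ofReal_abs, ← ENNReal.ofReal_mul (hg.pos_nonneg k j)]
  apply ENNReal.ofReal_le_ofReal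
  rw [abs_mul, abs_mul, abs_mul, abs_of_nonneg (hg.pos_nonneg k j)]
  apply le_of_eq; ring

end helpers

/-- ergodicity bound for the inhomogeneous queue with batch arrivals and
batch service, class IV.  Assume that a.e. in `t` the sequence `k ↦ μ_k(t)` is
nonincreasing (this guarantees nonnegativity of the off-diagonal entries of
`D B(t) D⁻¹`).  Then for any two solutions `p*`, `p**` of the forward Kolmogorov system
and any `0 ≤ s ≤ t` with `‖z*(s) − z**(s)‖_{1D} < ∞`,
`‖p*(t) − p**(t)‖ ≤ 4·exp(−∫_s^t α(u) du)·‖z*(s) − z**(s)‖_{1D}`; consequently, if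
`∫_0^∞ α(t) dt = +∞` then `‖p*(t) − p**(t)‖ → 0` as `t → ∞` (weak ergodicity). -/
theorem classIV_ergodicity_bound
    (lam mu : ℕ → ℝ → ℝ) (L : ℝ)
    (hlampos : ∀ k, ∀ t : ℝ, 0 ≤ t → 0 ≤ lam k t)
    (hmupos : ∀ k, ∀ t : ℝ, 0 ≤ t → 0 ≤ mu k t)
    (hlamloc : ∀ k, LocallyIntegrableOn (lam k) (Set.Ici 0))
    (hmuloc : ∀ k, LocallyIntegrableOn (mu k) (Set.Ici 0))
    (hlamsum : ∀ᵐ t : ℝ, 0 ≤ t → Summable (fun k : ℕ => lam (k + 1) t))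
    (hL : ∀ᵐ t : ℝ, 0 ≤ t → ∀ n,
      (∑' k : ℕ, lam (k + 1) t) + ∑ k ∈ Finset.Icc 1 n, mu k t ≤ L)
    (hmudec : ∀ᵐ t : ℝ, 0 ≤ t → ∀ k, 1 ≤ k → mu (k + 1) t ≤ mu k t)
    (d : ℕ → ℝ) (hd1 : d 1 = 1) (hdpos : ∀ k, 1 ≤ k → 0 < d k)
    (hdmono : ∀ k, 1 ≤ k → d k ≤ d (k + 1))
    (hsumfin : ∀ᵐ t : ℝ, 0 ≤ t → ∀ i, 1 ≤ i →
      Summable (fun k : ℕ => lam (k + 1) t * (d (k + 1 + i) / d i)))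
    (hαfin : ∀ᵐ t : ℝ, 0 ≤ t →
      BddBelow (Set.range fun i : ℕ => alphaIVi d lam mu (i + 1) t))
    (hαloc : LocallyIntegrableOn (alphaIV d lam mu) (Set.Ici 0))
    (p₁ p₂ : ℝ → ℕ → ℝ)
    (hp₁ : IsKolmogorovSolution (classIVMatrix lam mu) p₁)
    (hp₂ : IsKolmogorovSolution (classIVMatrix lam mu) p₂)
    (hfin0 : Norm1DFinite d (fun k => p₁ 0 k - p₂ 0 k)) :
    (∀ s t : ℝ, 0 ≤ s → s ≤ t →
      Norm1DFinite d (fun k => p₁ s k - p₂ s k) →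
      (∑' k : ℕ, |p₁ t k - p₂ t k|) ≤
        4 * Real.exp (-∫ u in s..t, alphaIV d lam mu u) *
          norm1D d (fun k => p₁ s k - p₂ s k)) ∧
    (Tendsto (fun T : ℝ => ∫ u in (0 : ℝ)..T, alphaIV d lam mu u) atTop atTop →
      Tendsto (fun t : ℝ => ∑' k : ℕ, |p₁ t k - p₂ t k|) atTop (𝓝 0)) := by
  have hgood : ∀ᵐ u : ℝ, 0 ≤ u → GoodAt lam mu L u := by
    filter_upwards [hlamsum, hL, hmudec] with u h1 h2 h3 hu
    exact ⟨fun k => hlampos k u hu, fun k => hmupos k u hu, h1 hu, h2 hu, h3 hu⟩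
  have hL0 : 0 ≤ L := by
    have h1 : ∀ᵐ u ∂(volume.restrict (Set.Ici (0:ℝ))), GoodAt lam mu L u :=
      (ae_restrict_iff' measurableSet_Ici).2 hgood
    have : NeBot (ae (volume.restrict (Set.Ici (0:ℝ)))) := by
      rw [ae_restrict_neBot]; simp
    obtain ⟨u, hu⟩ := h1.exists
    exact hu.Lpos
  have hd1' : ∀ k, 1 ≤ d (k + 1) := by
    intro k
    induction k with
    | zero => simp [hd1]
    | succ k ih => exact ih.trans (hdmono (k + 1) (by omega))
  have hα : ∀ s t, 0 ≤ s → s ≤ t → IntervalIntegrable (alphaIV d lam mu) volume s t := by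
    intro s t hs hst
    rw [intervalIntegrable_iff_integrableOn_Icc_of_le hst]
    exact hαloc.integrableOn_compact_subset (fun x hx => hs.trans hx.1) isCompact_Icc
  have main : ∀ s t : ℝ, 0 ≤ s → s ≤ t →
      Norm1DFinite d (fun k => p₁ s k - p₂ s k) →
      (∑' k : ℕ, |p₁ t k - p₂ t k|) ≤
        4 * Real.exp (-∫ u in s..t, alphaIV d lam mu u) *
          norm1D d (fun k => p₁ s k - p₂ s k) := by
    intro s t hs hst hfin
    have facts : ∀ u : ℝ, 0 ≤ u → _ := fun u hu => tailS_facts (p₁ u) (p₂ u) (hp₁.1 u hu).1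
      (hp₂.1 u hu).1 (hp₁.1 u hu).2 (hp₂.1 u hu).2
    set r : ℕ → ℝ → ENNReal := fun k u =>
      ENNReal.ofReal |Real.exp (L * (u - s)) * tailS (fun k => p₁ u k - p₂ u k) (k + 1)| with hr
    have hrs : ∀ k, r k s = ENNReal.ofReal |tailS (fun k => p₁ s k - p₂ s k) (k + 1)| := by
      intro k; simp [hr]
    have hdn : ∀ k, 0 ≤ d (k + 1) := fun k => zero_le_one.trans (hd1' k)
    have hV : ∑' k, ENNReal.ofReal (d (k + 1)) * r k s =
        ENNReal.ofReal (norm1D d (fun k => p₁ s k - p₂ s k)) := by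
      rw [norm1D, ENNReal.ofReal_tsum_of_nonneg (fun k => mul_nonneg (hdn k) (abs_nonneg _)) hfin]
      congr 1; ext k
      rw [hrs, ← ENNReal.ofReal_mul (hdn k), (facts s hs).2.2.2 (k + 1)]
    have hsub : Set.Ioi s ⊆ Set.Ici 0 := fun x hx => hs.trans (le_of_lt hx)
    have hcmp := comparison s (fun k j u => ENNReal.ofReal (tailMatrixPos L lam mu k j u)) r
      (fun k => ENNReal.ofReal (d (k + 1))) (fun k => ENNReal.ofReal_ne_top)
      (fun u => ENNReal.ofReal (L - alphaIV d lam mu u))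
      (fun u => ENNReal.ofReal (Real.exp (∫ v in s..u, (L - alphaIV d lam mu v))))
      (3 * L) (Real.exp (L * (t - s)) * 2) (by positivity) (by positivity)
      (fun k j => (((matrix_meas lam mu hlamloc hmuloc).2.2.2 L k j).mono_measure
        (Measure.restrict_mono hsub le_rfl)).ennreal_ofReal)
      (by
        intro x hx
        apply gron s x hx
        · exact (_root_.intervalIntegrable_const).sub (hα s x hs hx)
        · filter_upwards [hgood, hαfin] with u hu hb hm
          have hu0 : 0 ≤ u := hs.trans hm.1.le
          have := (hu hu0).alpha_le d hdpos (hb hu0)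
          linarith)
      t
      (by
        intro k x hx _
        rw [hrs]
        exact tail_integral_eq lam mu L hlamloc hmuloc hgood p₁ p₂ hp₁ hp₂ s x hs hx k)
      (by
        intro k x hx hxt
        apply ENNReal.ofReal_le_ofReal
        rw [abs_mul, abs_of_pos (Real.exp_pos _)]
        apply mul_le_mul _ ((facts x (hs.trans hx)).2.2.1 (k + 1)) (abs_nonneg _) (Real.exp_pos _).le
        apply Real.exp_le_exp.2
        exact mul_le_mul_of_nonneg_left (by linarith) hL0)
      (by
        filter_upwards [hgood] with u hu hm k
        exact (hu (hs.trans hm.le)).row k)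
      (by
        filter_upwards [hgood, hαfin, hsumfin] with u hu hb hsf hm j
        have hu0 : 0 ≤ u := hs.trans hm.le
        exact (hu hu0).col' d hdpos j (hsf hu0 (j + 1) (by omega)) (hb hu0))
      (by rw [hV]; exact ENNReal.ofReal_ne_top)
      t hst le_rfl
    rw [hV] at hcmp
    have hN0 : 0 ≤ norm1D d (fun k => p₁ s k - p₂ s k) :=
      tsum_nonneg fun k => mul_nonneg (hdn k) (abs_nonneg _)
    have hint : ∫ v in s..t, (L - alphaIV d lam mu v) =
        L * (t - s) - ∫ v in s..t, alphaIV d lam mu v := by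
      rw [intervalIntegral.integral_sub _root_.intervalIntegrable_const (hα s t hs hst)]
      simp; ring
    rw [hint, sub_eq_add_neg, Real.exp_add, ← ENNReal.ofReal_mul hN0] at hcmp
    have hfinal : ∑' k, ENNReal.ofReal |tailS (fun k => p₁ t k - p₂ t k) (k + 1)| ≤
        ENNReal.ofReal (Real.exp (-∫ v in s..t, alphaIV d lam mu v) *
          norm1D d (fun k => p₁ s k - p₂ s k)) := by
      have hE : 0 < Real.exp (L * (t - s)) := Real.exp_pos _
      have h1 : ENNReal.ofReal (Real.exp (L * (t - s))) *
          ∑' k, ENNReal.ofReal |tailS (fun k => p₁ t k - p₂ t k) (k + 1)| ≤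
          ENNReal.ofReal (Real.exp (L * (t - s))) *
          ENNReal.ofReal (Real.exp (-∫ v in s..t, alphaIV d lam mu v) *
          norm1D d (fun k => p₁ s k - p₂ s k)) := by
        rw [← ENNReal.ofReal_mul hE.le, ← ENNReal.tsum_mul_left]
        calc _ ≤ ∑' k, ENNReal.ofReal (d (k + 1)) * r k t := by
              apply ENNReal.tsum_le_tsum
              intro k
              rw [← ENNReal.ofReal_mul hE.le, ← ENNReal.ofReal_mul (hdn k)]
              apply ENNReal.ofReal_le_ofReal
              rw [abs_mul, abs_of_pos hE]
              exact le_mul_of_one_le_left (by positivity) (hd1' k)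
          _ ≤ _ := hcmp
          _ = _ := by congr 1; ring
      exact (ENNReal.mul_le_mul_iff_right (by simpa using hE) ENNReal.ofReal_ne_top).1 h1
    have hl := l1_le (tailS (fun k => p₁ t k - p₂ t k)) (by simp [tailS]) _
      (mul_nonneg (Real.exp_pos _).le hN0) hfinal
    rw [mul_assoc]
    refine le_trans (le_of_eq ?_) hl
    congr 1; ext k
    simp only [tailS, Finset.sum_range_succ]; congr 1; ring
  refine ⟨main, fun hT => ?_⟩
  have hE : Tendsto (fun t : ℝ => 4 * Real.exp (-∫ u in (0:ℝ)..t, alphaIV d lam mu u) *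
      norm1D d (fun k => p₁ 0 k - p₂ 0 k)) atTop (𝓝 (4 * 0 * norm1D d (fun k => p₁ 0 k - p₂ 0 k))) := by
    apply Tendsto.mul_const
    apply Tendsto.const_mul
    exact Real.tendsto_exp_neg_atTop_nhds_zero.comp hT
  rw [mul_zero, zero_mul] at hE
  refine squeeze_zero' (Eventually.of_forall fun t => tsum_nonneg fun k => abs_nonneg _) ?_ hE
  filter_upwards [eventually_ge_atTop 0] with t ht
  exact main 0 t le_rfl ht hfin0
end
end
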